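/- arXiv:0706.1326 — 2 statements merged into one kernel-verified Lean document; each statement's English description precedes it below -/
import Mathlib

section
/- For every positive integer m with m ≤ 9, every countable ultrahomogeneous metric space S_m with all distances in [0,1]_m into which every countable metric space with distances in [0,1]_m embeds isometrically is (2/m)-indivisible. -/
open Metric

/-- A metric space is ultrahomogeneous if every isometry between two finite
subspaces extends to a surjective self-isometry of the whole space. -/
def IsUltrahomogeneous (X : Type*) [MetricSpace X] : Prop :=
  ∀ F : Set X, F.Finite → ∀ φ : F → X, Isometry φ →
    ∃ ψ : X ≃ᵢ X, ∀ x : F, ψ x = φ x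

/-- A metric space `X` is `ε`-indivisible if for every finite coloring there
is a color `i` and a subset `Y ⊆ X` isometric to `X` with every point of `Y`
within distance `ε` of the `i`-th color class. -/
def EpsIndivisible (X : Type*) [MetricSpace X] (ε : ℝ) : Prop :=
  ∀ k : ℕ, 0 < k → ∀ χ : X → Fin k, ∃ i : Fin k, ∃ e : X → X, Isometry e ∧
    ∀ z : X, ∃ x : X, χ x = i ∧ dist (e z) x ≤ ε

/-- Approximate indivisibility (oscillation stability): `ε`-indivisible for
every `ε > 0`. -/
def ApproxIndivisible (X : Type*) [MetricSpace X] : Prop :=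
  ∀ ε : ℝ, 0 < ε → EpsIndivisible X ε

/-- Exact indivisibility: some color class contains an isometric copy of `X`. -/
def Indivisible (X : Type*) [MetricSpace X] : Prop :=
  ∀ k : ℕ, 0 < k → ∀ χ : X → Fin k, ∃ i : Fin k, ∃ e : X → X, Isometry e ∧
    ∀ z : X, χ (e z) = i

/-- The Urysohn sphere: complete, separable, ultrahomogeneous, of diameter at
most `1`, and universal for separable metric spaces of diameter at most `1`. -/
def IsUrysohnSphere (S : Type) [MetricSpace S] : Prop :=
  CompleteSpace S ∧ TopologicalSpace.SeparableSpace S ∧ IsUltrahomogeneous S ∧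
  (∀ x y : S, dist x y ≤ 1) ∧
  ∀ (Y : Type) [MetricSpace Y], TopologicalSpace.SeparableSpace Y →
    (∀ a b : Y, dist a b ≤ 1) → ∃ f : Y → S, Isometry f

/-- The rational Urysohn sphere: countable, ultrahomogeneous, with distances in
`ℚ ∩ [0,1]`, universal for countable metric spaces with distances in `ℚ ∩ [0,1]`. -/
def IsRationalUrysohnSphere (S : Type) [MetricSpace S] : Prop :=
  Countable S ∧ IsUltrahomogeneous S ∧
  (∀ x y : S, ∃ q : ℚ, 0 ≤ q ∧ q ≤ 1 ∧ dist x y = q) ∧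
  ∀ (Y : Type) [MetricSpace Y], Countable Y →
    (∀ a b : Y, ∃ q : ℚ, 0 ≤ q ∧ q ≤ 1 ∧ dist a b = q) →
    ∃ f : Y → S, Isometry f

/-- `[0,1]_m = {k/m : 0 ≤ k ≤ m}`. -/
def distSetM (m : ℕ) : Set ℝ := {d | ∃ k : ℕ, k ≤ m ∧ d = (k : ℝ) / m}

/-- The space `S_m`: countable, ultrahomogeneous, with distances in `[0,1]_m`,
universal for countable metric spaces with distances in `[0,1]_m`. -/
def IsUrysohnSphereM (m : ℕ) (S : Type) [MetricSpace S] : Prop :=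
  Countable S ∧ IsUltrahomogeneous S ∧
  (∀ x y : S, dist x y ∈ distSetM m) ∧
  ∀ (Y : Type) [MetricSpace Y], Countable Y →
    (∀ a b : Y, dist a b ∈ distSetM m) → ∃ f : Y → S, Isometry f

/-- The sequence whose `n`-th term is chosen to satisfy `P n` given the previous terms. -/
noncomputable def epsilonSeq {α : Type*} [Nonempty α]
    (P : ∀ n : ℕ, (Fin n → α) → α → Prop) (n : ℕ) : α :=
  Classical.epsilon (P n fun i => epsilonSeq P i)
decreasing_by exact i.2

theorem exists_seq_of_step {α : Type*} [Nonempty α] (P : ∀ n : ℕ, (Fin n → α) → α → Prop)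
    (step : ∀ (n : ℕ) (s : ℕ → α), (∀ j < n, P j (fun i => s i) (s j)) →
      ∃ a, P n (fun i => s i) a) :
    ∃ s : ℕ → α, ∀ n, P n (fun i => s i) (s n) := by
  refine ⟨epsilonSeq P, fun n => ?_⟩
  induction n using Nat.strong_induction_on with
  | _ n ih =>
    rw [epsilonSeq]
    exact Classical.epsilon_spec (step n (epsilonSeq P) ih)

/-- An integer-valued metric on `ℕ` with distances at most `3`. -/
structure IsMetricThree (D : ℕ → ℕ → ℕ) : Prop where
  self : ∀ a, D a a = 0
  symm : ∀ a b, D a b = D b a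
  pos : ∀ a b, a ≠ b → 1 ≤ D a b
  le : ∀ a b, D a b ≤ 3
  triangle : ∀ a b c, D a c ≤ D a b + D b c

/-- A one-point extension of `D` (a Katětov function) with values in `{1, 2, 3}`. -/
def IsKatetov (D : ℕ → ℕ → ℕ) (f : ℕ → ℕ) : Prop :=
  (∀ a, 1 ≤ f a ∧ f a ≤ 3) ∧ ∀ a b, a ≠ b → f a ≤ f b + D a b ∧ D a b ≤ f a + f b

theorem IsMetricThree.isKatetov_of_two_le {D : ℕ → ℕ → ℕ} (hD : IsMetricThree D) {f : ℕ → ℕ}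
    (hf : ∀ a, 2 ≤ f a ∧ f a ≤ 3) : IsKatetov D f := by
  refine ⟨fun a => ⟨by have := hf a; omega, (hf a).2⟩, fun a b hab => ?_⟩
  have := hf a
  have := hf b
  have := hD.pos a b hab
  have := hD.le a b
  omega

theorem IsKatetov.truncate {D : ℕ → ℕ → ℕ} (hD : IsMetricThree D) {f : ℕ → ℕ}
    (hf : IsKatetov D f) (N : ℕ) : IsKatetov D (fun a => if a < N then f a else 2) := by
  refine ⟨fun a => ?_, fun a b hab => ?_⟩
  · have := hf.1 a
    dsimp only
    split_ifs <;> omega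
  · have := hf.1 a
    have := hf.1 b
    have := hf.2 a b hab
    have := hD.pos a b hab
    have := hD.le a b
    dsimp only
    split_ifs <;> omega

/-- Compatibility of a new row of distances to `0, …, n - 1` with the previous rows. -/
def IsRow (n : ℕ) (s : Fin n → ℕ → ℕ) (f : ℕ → ℕ) : Prop :=
  (∀ a : Fin n, 1 ≤ f a ∧ f a ≤ 3) ∧
    ∀ a b : Fin n, a < b → f a ≤ f b + s b a ∧ f b ≤ f a + s b a ∧ s b a ≤ f a + f b

/-- The function coded by `n`; each finitely supported one is coded infinitely often. -/
def codedFun (n a : ℕ) : ℕ :=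
  ((Encodable.decode n.unpair.2 : Option (List ℕ)).getD []).getD a 2

theorem exists_codedFun (f : ℕ → ℕ) (N : ℕ) :
    ∃ n ≥ N, codedFun n = fun a => if a < N then f a else 2 := by
  refine ⟨Nat.pair N (Encodable.encode ((List.range N).map f)), Nat.left_le_pair _ _, ?_⟩
  funext a
  simp only [codedFun, Nat.unpair_pair, Encodable.encodek, Option.getD_some]
  by_cases h : a < N
  · simp [h]
  · simp [h]

/-- There is a countable generic metric space with distances in `{1, 2, 3}`. -/
theorem exists_generic_metricThree :
    ∃ D : ℕ → ℕ → ℕ, IsMetricThree D ∧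
      ∀ f, IsKatetov D f → ∀ N, ∃ x ≥ N, ∀ a < N, D x a = f a := by
  obtain ⟨s, hs⟩ := exists_seq_of_step
    (fun (n : ℕ) (s : Fin n → ℕ → ℕ) (f : ℕ → ℕ) => IsRow n s f ∧
      (IsRow n s (codedFun n) → f = codedFun n)) (fun n s hs => by
    by_cases h : IsRow n (fun i => s i) (codedFun n)
    · exact ⟨_, h, fun _ => rfl⟩
    · refine ⟨fun _ => 2, ⟨fun a => by simp, fun a b hab => ?_⟩, fun h' => absurd h' h⟩
      have := (hs b b.2).1.1 ⟨a, hab⟩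
      dsimp only at this ⊢
      omega)
  have hval : ∀ a b : ℕ, a < b → 1 ≤ s b a ∧ s b a ≤ 3 := fun a b hab =>
    (hs b).1.1 ⟨a, hab⟩
  have htri : ∀ a b c : ℕ, a < b → b < c →
      s c a ≤ s c b + s b a ∧ s c b ≤ s c a + s b a ∧ s b a ≤ s c a + s c b :=
    fun a b c hab hbc => (hs c).1.2 ⟨a, hab.trans hbc⟩ ⟨b, hbc⟩ hab
  let D : ℕ → ℕ → ℕ := fun a b => if a < b then s b a else if b < a then s a b else 0
  have hlt : ∀ a b, a < b → D a b = s b a := fun a b h => by simp [D, h]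
  have hgt : ∀ a b, a < b → D b a = s b a := fun a b h => by simp [D, h, h.le]
  have hself : ∀ a, D a a = 0 := fun a => by simp [D]
  have hD : IsMetricThree D := by
    refine ⟨hself, fun a b => ?_, fun a b hab => ?_, fun a b => ?_, fun a b c => ?_⟩
    · rcases lt_trichotomy a b with h | rfl | h
      · rw [hlt _ _ h, hgt _ _ h]
      · rfl
      · rw [hlt _ _ h, hgt _ _ h]
    · rcases lt_or_gt_of_ne hab with h | h
      · rw [hlt _ _ h]; exact (hval _ _ h).1
      · rw [hgt _ _ h]; exact (hval _ _ h).1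
    · rcases lt_trichotomy a b with h | rfl | h
      · rw [hlt _ _ h]; exact (hval _ _ h).2
      · simp [hself]
      · rw [hgt _ _ h]; exact (hval _ _ h).2
    · by_cases h1 : a = b
      · subst h1; simp [hself]
      by_cases h2 : b = c
      · subst h2; simp [hself]
      by_cases h3 : a = c
      · subst h3; simp [hself]
      have hsymm : ∀ x y, D x y = D y x := fun x y => by
        rcases lt_trichotomy x y with h | rfl | h
        · rw [hlt _ _ h, hgt _ _ h]
        · rfl
        · rw [hlt _ _ h, hgt _ _ h]
      have key : ∀ x y z : ℕ, x < y → y < z →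
          D x z ≤ D y z + D x y ∧ D y z ≤ D x z + D x y ∧ D x y ≤ D x z + D y z := by
        intro x y z hxy hyz
        rw [hlt _ _ hxy, hlt _ _ hyz, hlt _ _ (hxy.trans hyz)]
        exact htri x y z hxy hyz
      have := hsymm a b
      have := hsymm b c
      have := hsymm a c
      have := key a b c
      have := key a c b
      have := key b a c
      have := key b c a
      have := key c a b
      have := key c b a
      omega
  refine ⟨D, hD, fun f hf N => ?_⟩
  obtain ⟨n, hn, hcode⟩ := exists_codedFun f N
  have hf' := hf.truncate hD N
  rw [← hcode] at hf'
  refine ⟨n, hn, fun a ha => ?_⟩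
  have hrow : IsRow n (fun i => s i) (codedFun n) := by
    refine ⟨fun a => hf'.1 a, fun a b hab => ?_⟩
    have hab' : (a : ℕ) < b := hab
    have h1 := hf'.2 a b hab'.ne
    have h2 := hf'.2 b a hab'.ne'
    rw [hlt _ _ hab'] at h1
    rw [hgt _ _ hab'] at h2
    dsimp only
    omega
  rw [hgt _ _ (ha.trans_le hn), (hs n).2 hrow, hcode]
  simp [ha]

/-- The colour `c` is realized over every extension of `f` restricted to `{0, …, N - 1}`. -/
def Full {k : ℕ} (D : ℕ → ℕ → ℕ) (χ : ℕ → Fin k) (c : Fin k) (N : ℕ) (f : ℕ → ℕ) : Prop :=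
  ∀ N' ≥ N, ∀ f', IsKatetov D f' → (∀ a < N, f' a = f a) →
    ∃ x ≥ N', (∀ a < N', D x a = f' a) ∧ χ x = c

theorem Full.mono {k : ℕ} {D : ℕ → ℕ → ℕ} {χ : ℕ → Fin k} {c : Fin k} {N N' : ℕ} {f f' : ℕ → ℕ}
    (h : Full D χ c N f) (hN : N ≤ N') (hf : ∀ a < N, f' a = f a) : Full D χ c N' f' :=
  fun N'' hN'' f'' hK hf'' => h N'' (hN.trans hN'') f'' hK fun a ha =>
    (hf'' a (ha.trans_le hN)).trans (hf a ha)

theorem exists_full {k : ℕ} {D : ℕ → ℕ → ℕ}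
    (hext : ∀ f, IsKatetov D f → ∀ N, ∃ x ≥ N, ∀ a < N, D x a = f a)
    (χ : ℕ → Fin k) (N : ℕ) {f : ℕ → ℕ} (hf : IsKatetov D f) :
    ∃ c, ∃ N' ≥ N, ∃ f', IsKatetov D f' ∧ (∀ a < N, f' a = f a) ∧ Full D χ c N' f' := by
  by_contra hcon
  have key : ∀ t : Finset (Fin k), ∃ N' ≥ N, ∃ f', IsKatetov D f' ∧ (∀ a < N, f' a = f a) ∧
      ∀ x ≥ N', (∀ a < N', D x a = f' a) → χ x ∉ t := by
    intro t
    induction t using Finset.induction_on with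
    | empty => exact ⟨N, le_rfl, f, hf, fun _ _ => rfl, fun _ _ _ => Finset.notMem_empty _⟩
    | insert c t _ ih =>
      obtain ⟨N', hN', f', hK, hf', hx⟩ := ih
      have hnot : ¬ Full D χ c N' f' := fun h => hcon ⟨c, N', hN', f', hK, hf', h⟩
      simp only [Full, not_forall] at hnot
      obtain ⟨N'', hN'', f'', hK', hf'', hno⟩ := hnot
      refine ⟨N'', hN'.trans hN'', f'', hK',
        fun a ha => (hf'' a (ha.trans_le hN')).trans (hf' a ha), fun x hxN hxa hmem => ?_⟩
      rcases Finset.mem_insert.1 hmem with h | h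
      · exact hno ⟨x, hxN, hxa, h⟩
      · exact hx x (hN''.trans hxN)
          (fun a ha => (hxa a (ha.trans_le hN'')).trans (hf'' a ha)) h
  obtain ⟨N', -, f', hK, -, hx⟩ := key Finset.univ
  obtain ⟨x, hxN, hxa⟩ := hext f' hK N'
  exact hx x hxN hxa (Finset.mem_univ _)

/-- Every `{2, 3}`-valued function extending `g` restricted to `{0, …, N₀ - 1}` has an extension
over which the colour `c` is always realized. -/
def Uniform {k : ℕ} (D : ℕ → ℕ → ℕ) (χ : ℕ → Fin k) (c : Fin k) (N₀ : ℕ) (g : ℕ → ℕ) : Prop :=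
  ∀ N ≥ N₀, ∀ f : ℕ → ℕ, (∀ a, 2 ≤ f a ∧ f a ≤ 3) → (∀ a < N₀, f a = g a) →
    ∃ N' ≥ N, ∃ f', IsKatetov D f' ∧ (∀ a < N, f' a = f a) ∧ (∀ a ≥ N', f' a = 2) ∧
      Full D χ c N' f'

theorem exists_uniform {k : ℕ} {D : ℕ → ℕ → ℕ} (hD : IsMetricThree D)
    (hext : ∀ f, IsKatetov D f → ∀ N, ∃ x ≥ N, ∀ a < N, D x a = f a) (χ : ℕ → Fin k) :
    ∃ c N₀ g, (∀ a, 2 ≤ g a ∧ g a ≤ 3) ∧ (∀ a ≥ N₀, g a = 2) ∧ Uniform D χ c N₀ g := by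
  by_contra hcon
  have key : ∀ t : Finset (Fin k), ∃ N₀, ∃ g : ℕ → ℕ, (∀ a, 2 ≤ g a ∧ g a ≤ 3) ∧
      (∀ a ≥ N₀, g a = 2) ∧ ∀ c ∈ t, ∀ N' ≥ N₀, ∀ f', IsKatetov D f' →
        (∀ a < N₀, f' a = g a) → ¬ Full D χ c N' f' := by
    intro t
    induction t using Finset.induction_on with
    | empty => exact ⟨0, fun _ => 2, by simp, by simp, by simp⟩
    | insert c t _ ih =>
      obtain ⟨N₀, g, hg, hg2, ht⟩ := ih
      have hnot : ¬ Uniform D χ c N₀ g := fun h => hcon ⟨c, N₀, g, hg, hg2, h⟩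
      simp only [Uniform, not_forall] at hnot
      obtain ⟨N, hN, f, hf, hfg, hno⟩ := hnot
      refine ⟨N, fun a => if a < N then f a else 2, fun a => ?_, fun a ha => ?_, ?_⟩
      · have := hf a
        dsimp only
        split_ifs <;> omega
      · simp [ha.not_gt]
      · intro c' hc' N' hN' f' hK hf' hfull
        replace hf' : ∀ a < N, f' a = f a := fun a ha => (hf' a ha).trans (if_pos ha)
        rcases Finset.mem_insert.1 hc' with rfl | hc'
        · refine hno ⟨N', hN', _, hK.truncate hD N', fun a ha => ?_, fun a ha => ?_,
            hfull.mono le_rfl fun a ha => if_pos ha⟩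
          · rw [if_pos (ha.trans_le hN'), hf' a ha]
          · simp [ha.not_gt]
        · exact ht c' hc' N' (hN.trans hN') f' hK
            (fun a ha => (hf' a (ha.trans_le hN)).trans (hfg a ha)) hfull
  obtain ⟨N₀, g, hg, -, hno⟩ := key Finset.univ
  obtain ⟨c, N', hN', f', hK, hf', hfull⟩ :=
    exists_full hext χ N₀ (hD.isKatetov_of_two_le hg)
  exact hno c (Finset.mem_univ c) N' hN' f' hK hf' hfull

theorem Uniform.exists_family {k : ℕ} {D : ℕ → ℕ → ℕ} {χ : ℕ → Fin k} {c : Fin k} {N₀ : ℕ}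
    {g : ℕ → ℕ} (hU : Uniform D χ c N₀ g) {ι : Type*} [DecidableEq ι] (t : Finset ι)
    (base : ι → ℕ → ℕ) (hbase : ∀ q a, 2 ≤ base q a ∧ base q a ≤ 3)
    (hg : ∀ q, ∀ a < N₀, base q a = g a) {M : ℕ} (hM : N₀ ≤ M) :
    ∃ L ≥ M, ∃ H : ι → ℕ → ℕ,
      (∀ q ∈ t, IsKatetov D (H q) ∧ (∀ a < M, H q a = base q a) ∧ (∀ a ≥ L, H q a = 2) ∧
        Full D χ c L (H q)) ∧
      ∀ q ∈ t, ∀ q' ∈ t, q ≠ q' → ∀ a ≥ M, H q a = 2 ∨ H q' a = 2 := by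
  induction t using Finset.induction_on with
  | empty => exact ⟨M, le_rfl, base, by simp, by simp⟩
  | insert p t hp ih =>
    obtain ⟨L, hL, H, hH, hcross⟩ := ih
    obtain ⟨L', hL', f, hK, hf, htail, hfull⟩ := hU L (hM.trans hL)
      (fun a => if a < M then base p a else 2)
      (fun a => by have := hbase p a; split_ifs <;> omega)
      (fun a ha => by rw [if_pos (ha.trans_le hM), hg p a ha])
    have hne : ∀ q ∈ t, q ≠ p := fun q hq h => hp (h ▸ hq)
    have hnew : ∀ q ∈ t, ∀ a ≥ M, f a = 2 ∨ H q a = 2 := fun q hq a ha => by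
      rcases lt_or_ge a L with h | h
      · left
        rw [hf a h]
        exact if_neg ha.not_gt
      · exact Or.inr ((hH q hq).2.2.1 a h)
    refine ⟨L', hL.trans hL', Function.update H p f, fun q hq => ?_, fun q hq q' hq' hqq => ?_⟩
    · rcases Finset.mem_insert.1 hq with rfl | hq
      · rw [Function.update_self]
        exact ⟨hK, fun a ha => by rw [hf a (ha.trans_le hL), if_pos ha], htail, hfull⟩
      · rw [Function.update_of_ne (hne q hq)]
        obtain ⟨h1, h2, h3, h4⟩ := hH q hq
        exact ⟨h1, h2, fun a ha => h3 a (hL'.trans ha), h4.mono hL' fun _ _ => rfl⟩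
    · rcases Finset.mem_insert.1 hq with rfl | hqt <;>
        rcases Finset.mem_insert.1 hq' with rfl | hqt'
      · exact absurd rfl hqq
      · rw [Function.update_self, Function.update_of_ne (hne q' hqt')]
        exact hnew q' hqt'
      · rw [Function.update_self, Function.update_of_ne (hne q hqt)]
        exact fun a ha => (hnew q hqt a ha).symm
      · rw [Function.update_of_ne (hne q hqt), Function.update_of_ne (hne q' hqt')]
        exact hcross q hqt q' hqt' hqq

/-- A function with prescribed values at the points of a finite injective sequence. -/
theorem exists_prescribed {n : ℕ} {r : ℕ → ℕ} (hr : ∀ i < n, ∀ j < n, r i = r j → i = j)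
    (v K : ℕ → ℕ) :
    ∃ f : ℕ → ℕ, (∀ j < n, f (r j) = v j) ∧ ∀ a, (∀ j < n, r j ≠ a) → f a = K a := by
  classical
  refine ⟨fun a => if h : ∃ j < n, r j = a then v h.choose else K a, fun j hj => ?_,
    fun a ha => dif_neg fun ⟨j, hj, h⟩ => ha j hj h⟩
  have h : ∃ i < n, r i = r j := ⟨j, hj, rfl⟩
  dsimp only
  rw [dif_pos h, hr _ h.choose_spec.1 j hj h.choose_spec.2]

theorem IsKatetov.of_prescribed {D : ℕ → ℕ → ℕ} (hD : IsMetricThree D) {n : ℕ} {r t K f : ℕ → ℕ}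
    (hK : IsKatetov D K) (hft : ∀ j < n, f (r j) = t j)
    (hfK : ∀ a, (∀ j < n, r j ≠ a) → f a = K a) (ht : ∀ j < n, 1 ≤ t j ∧ t j ≤ 3)
    (hpair : ∀ i < n, ∀ j < n, i ≠ j →
      t i ≤ t j + D (r i) (r j) ∧ D (r i) (r j) ≤ t i + t j)
    (hmix : ∀ j < n, ∀ b, (∀ i < n, r i ≠ b) →
      t j ≤ K b + D (r j) b ∧ K b ≤ t j + D (r j) b ∧ D (r j) b ≤ t j + K b) :
    IsKatetov D f := by
  refine ⟨fun a => ?_, fun a b hab => ?_⟩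
  · by_cases ha : ∃ j < n, r j = a
    · obtain ⟨j, hj, rfl⟩ := ha
      rw [hft j hj]
      exact ht j hj
    · push Not at ha
      rw [hfK a ha]
      exact hK.1 a
  · by_cases ha : ∃ j < n, r j = a <;> by_cases hb : ∃ j < n, r j = b
    · obtain ⟨i, hi, rfl⟩ := ha
      obtain ⟨j, hj, rfl⟩ := hb
      rw [hft i hi, hft j hj]
      exact hpair i hi j hj fun h => hab (by rw [h])
    · obtain ⟨i, hi, rfl⟩ := ha
      push Not at hb
      rw [hft i hi, hfK b hb]
      have := hmix i hi b hb
      omega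
    · obtain ⟨j, hj, rfl⟩ := hb
      push Not at ha
      rw [hft j hj, hfK a ha, hD.symm a]
      have := hmix j hj a ha
      omega
    · push Not at ha hb
      rw [hfK a ha, hfK b hb]
      exact hK.2 a b hab

/-- The data chosen at one stage of the construction of a monochromatic copy: a point `r`, and
families `H` of one-point extensions branching above `M` and decided below `L`. -/
structure StageData where
  M : ℕ
  L : ℕ
  H : Finset ℕ → ℕ → ℕ
  r : ℕ

instance : Nonempty StageData := ⟨⟨0, 0, fun _ _ => 0, 0⟩⟩

/-- The requirements on the data `d` of stage `n`, given the earlier stages `s`. -/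
structure IsStage {k : ℕ} (D τ : ℕ → ℕ → ℕ) (χ : ℕ → Fin k) (c : Fin k) (N₀ : ℕ) (g : ℕ → ℕ)
    (n : ℕ) (s : Fin n → StageData) (d : StageData) : Prop where
  N₀_le : N₀ ≤ d.M
  lt_M : ∀ j, (s j).r < d.M
  M_le : d.M ≤ d.L
  L_le : d.L ≤ d.r
  isKatetov : ∀ q ⊆ Finset.range n, IsKatetov D (d.H q)
  H_r : ∀ q ⊆ Finset.range n, ∀ j, d.H q (s j).r = if (j : ℕ) ∈ q then 3 else 2
  H_eq : ∀ q ⊆ Finset.range n, ∀ x < d.M, (∀ j, (s j).r ≠ x) → d.H q x = g x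
  tail : ∀ q ⊆ Finset.range n, ∀ x ≥ d.L, d.H q x = 2
  full : ∀ q ⊆ Finset.range n, Full D χ c d.L (d.H q)
  cross : ∀ q ⊆ Finset.range n, ∀ q' ⊆ Finset.range n, q ≠ q' →
    ∀ x ≥ d.M, d.H q x = 2 ∨ d.H q' x = 2
  dist : ∀ j : Fin n, D d.r (s j).r = τ n j
  far : (∀ j : Fin n, τ n j ≠ 1) → ∀ x < d.L, (∀ j, (s j).r ≠ x) → D d.r x = g x
  close : ∀ i : Fin n, τ n i = 1 → (∀ j < i, τ n j ≠ 1) → ∀ x < d.L, (∀ j, (s j).r ≠ x) →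
    D d.r x = (s i).H ((Finset.range i).filter fun j => τ n j = 3) x
  color : χ d.r = c

theorem exists_isStage {k : ℕ} {D τ : ℕ → ℕ → ℕ} (hD : IsMetricThree D) (hτ : IsMetricThree τ)
    {χ : ℕ → Fin k} {c : Fin k} {N₀ : ℕ} {g : ℕ → ℕ} (hg : ∀ a, 2 ≤ g a ∧ g a ≤ 3)
    (hg2 : ∀ a ≥ N₀, g a = 2) (hU : Uniform D χ c N₀ g) (n : ℕ) (s : ℕ → StageData)
    (hs : ∀ j < n, IsStage D τ χ c N₀ g j (fun i => s i) (s j)) :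
    ∃ d, IsStage D τ χ c N₀ g n (fun i => s i) d := by
  classical
  have hML : ∀ j < n, (s j).M ≤ (s j).L := fun j hj => (hs j hj).M_le
  have hLr : ∀ j < n, (s j).L ≤ (s j).r := fun j hj => (hs j hj).L_le
  have hNM : ∀ j < n, N₀ ≤ (s j).M := fun j hj => (hs j hj).N₀_le
  have hrM : ∀ i j, i < j → j < n → (s i).r < (s j).M := fun i j hij hj => (hs j hj).lt_M ⟨i, hij⟩
  have hdist : ∀ i j, i < j → j < n → D (s j).r (s i).r = τ j i := fun i j hij hj =>
    (hs j hj).dist ⟨i, hij⟩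
  have hrlt : ∀ i j, i < j → j < n → (s i).r < (s j).r := fun i j hij hj => by
    have := hrM i j hij hj
    have := hML j hj
    have := hLr j hj
    omega
  have hrN : ∀ j < n, N₀ ≤ (s j).r := fun j hj =>
    (hNM j hj).trans ((hML j hj).trans (hLr j hj))
  have hinj : ∀ i < n, ∀ j < n, (s i).r = (s j).r → i = j := fun i hi j hj h => by
    rcases lt_trichotomy i j with h' | h' | h'
    · exact absurd h (hrlt i j h' hj).ne
    · exact h'
    · exact absurd h (hrlt j i h' hi).ne'
  obtain ⟨M, hM, hrltM⟩ : ∃ M ≥ N₀, ∀ j < n, (s j).r < M := by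
    refine ⟨max N₀ ((Finset.range n).sup (fun j => (s j).r) + 1), le_max_left _ _,
      fun j hj => lt_max_of_lt_right (Nat.lt_succ_of_le ?_)⟩
    exact Finset.le_sup (f := fun j => (s j).r) (Finset.mem_range.2 hj)
  choose base hbr hbg using fun q : Finset ℕ =>
    exists_prescribed hinj (fun j => if j ∈ q then 3 else 2) g
  obtain ⟨L, hL, H, hH, hcross⟩ := hU.exists_family (Finset.range n).powerset base
    (fun q a => by
      by_cases ha : ∃ j < n, (s j).r = a
      · obtain ⟨j, hj, rfl⟩ := ha
        rw [hbr q j hj]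
        split_ifs <;> omega
      · push Not at ha
        rw [hbg q a ha]
        exact hg a)
    (fun q a ha => hbg q a fun j hj => (ha.trans_le (hrN j hj)).ne') hM
  simp only [Finset.mem_powerset] at hH hcross
  suffices hpt : ∃ x ≥ L, χ x = c ∧ (∀ j < n, D x (s j).r = τ n j) ∧
      ((∀ j < n, τ n j ≠ 1) → ∀ y < L, (∀ j < n, (s j).r ≠ y) → D x y = g y) ∧
      ∀ i < n, τ n i = 1 → (∀ j < i, τ n j ≠ 1) → ∀ y < L, (∀ j < n, (s j).r ≠ y) →
        D x y = (s i).H ((Finset.range i).filter fun j => τ n j = 3) y by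
    obtain ⟨x, hxL, hxc, hxd, hxf, hxcl⟩ := hpt
    exact ⟨⟨M, L, H, x⟩,
      { N₀_le := hM
        lt_M := fun j => hrltM j j.2
        M_le := hL
        L_le := hxL
        isKatetov := fun q hq => (hH q hq).1
        H_r := fun q hq j => ((hH q hq).2.1 _ (hrltM j j.2)).trans (hbr q j j.2)
        H_eq := fun q hq y hy hne =>
          ((hH q hq).2.1 y hy).trans (hbg q y fun j hj => hne ⟨j, hj⟩)
        tail := fun q hq => (hH q hq).2.2.1
        full := fun q hq => (hH q hq).2.2.2
        cross := hcross
        dist := fun j => hxd j j.2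
        far := fun h y hy hne =>
          hxf (fun j hj => h ⟨j, hj⟩) y hy fun j hj => hne ⟨j, hj⟩
        close := fun i hi h y hy hne =>
          hxcl i i.2 hi (fun j hj => h ⟨j, hj.trans i.2⟩ hj) y hy fun j hj => hne ⟨j, hj⟩
        color := hxc }⟩
  have hτn : ∀ j < n, 1 ≤ τ n j ∧ τ n j ≤ 3 := fun j hj => ⟨hτ.pos n j hj.ne', hτ.le n j⟩
  have hrL : ∀ j < n, (s j).r < L := fun j hj => (hrltM j hj).trans_le hL
  by_cases hfar : ∀ j < n, τ n j ≠ 1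
  · obtain ⟨f, hfr, hfg⟩ := exists_prescribed hinj (τ n) g
    obtain ⟨N, hN, f', hK, hf', -, hfull⟩ := hU L (hM.trans hL) f
      (fun a => by
        by_cases ha : ∃ j < n, (s j).r = a
        · obtain ⟨j, hj, rfl⟩ := ha
          have := hτn j hj
          have := hfar j hj
          rw [hfr j hj]
          omega
        · push Not at ha
          rw [hfg a ha]
          exact hg a)
      (fun a ha => hfg a fun j hj => (ha.trans_le (hrN j hj)).ne')
    obtain ⟨x, hx, hxf, hxc⟩ := hfull N le_rfl f' hK fun _ _ => rfl
    have hxf' : ∀ a < L, D x a = f a := fun a ha => (hxf a (ha.trans_le hN)).trans (hf' a ha)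
    refine ⟨x, le_trans hN hx, hxc, fun j hj => (hxf' _ (hrL j hj)).trans (hfr j hj),
      fun _ y hy hne => (hxf' y hy).trans (hfg y hne), fun i hi h => absurd h (hfar i hi)⟩
  · obtain ⟨i₀, ⟨hi₀, hτi₀⟩, hmin⟩ : ∃ i₀, (i₀ < n ∧ τ n i₀ = 1) ∧ ∀ j < i₀, τ n j ≠ 1 := by
      have hex : ∃ i, i < n ∧ τ n i = 1 := by
        push Not at hfar
        exact hfar
      refine ⟨Nat.find hex, Nat.find_spec hex, fun j hj h => Nat.find_min hex hj ⟨?_, h⟩⟩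
      exact hj.trans (Nat.find_spec hex).1
    obtain ⟨q₀, hq₀⟩ : ∃ q₀, q₀ = (Finset.range i₀).filter fun j => τ n j = 3 := ⟨_, rfl⟩
    have hq₀i : q₀ ⊆ Finset.range i₀ := hq₀ ▸ Finset.filter_subset _ _
    have hst := hs i₀ hi₀
    have hKK := hst.isKatetov q₀ hq₀i
    have hKr : ∀ j < i₀, (s i₀).H q₀ (s j).r = τ n j := fun j hj => by
      have h1 := hst.H_r q₀ hq₀i ⟨j, hj⟩
      dsimp only at h1
      have h2 := hτn j (hj.trans hi₀)
      have h3 := hmin j hj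
      rw [h1, hq₀]
      by_cases h4 : τ n j = 3
      · simp [hj, h4]
      · simp only [Finset.mem_filter, h4, and_false, if_false]
        omega
    obtain ⟨f, hfr, hfK⟩ := exists_prescribed hinj (τ n) ((s i₀).H q₀)
    have hKatf : IsKatetov D f := by
      refine hKK.of_prescribed hD hfr hfK hτn (fun i hi j hj hij => ?_) fun j hj b hb => ?_
      · have h : D (s i).r (s j).r = τ i j := by
          rcases lt_or_gt_of_ne hij with h | h
          · rw [hD.symm, hdist i j h hj, hτ.symm]
          · exact hdist j i h hi
        rw [h]
        have := hτ.triangle n j i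
        have := hτ.symm i j
        have := hτ.triangle i n j
        have := hτ.symm i n
        omega
      · have ht := hτn j hj
        have hKb := hKK.1 b
        have hd1 := hD.pos _ _ (hb j hj)
        have hd3 := hD.le (s j).r b
        rcases lt_or_ge j i₀ with hji | hji
        · have h1 := hKK.2 _ _ (hb j hj)
          have h2 := hKK.2 _ _ (hb j hj).symm
          rw [hKr j hji] at h1 h2
          rw [hD.symm b] at h2
          omega
        by_cases hbL : (s i₀).L ≤ b
        · have := hst.tail q₀ hq₀i b hbL
          omega
        have hLL : (s i₀).L ≤ (s j).L := by
          rcases hji.eq_or_lt with rfl | h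
          · rfl
          · have := hrM i₀ j h hj
            have := hLr i₀ hi₀
            have := hML j hj
            omega
        have hbLj : b < (s j).L := by omega
        have hgb := hg b
        have hne : ∀ i : Fin j, (s i).r ≠ b := fun i => hb i (i.2.trans hj)
        have hKg : b < (s i₀).M → (s i₀).H q₀ b = g b := fun h =>
          hst.H_eq q₀ hq₀i b h fun i => hb i (i.2.trans hi₀)
        have hg2b := hg2 b
        have hNM₀ := hNM i₀ hi₀
        by_cases hfarj : ∀ i : Fin j, τ j i ≠ 1
        · have := (hs j hj).far hfarj b hbLj hne
          by_cases h : b < (s i₀).M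
          · have := hKg h
            omega
          · omega
        · obtain ⟨i₁, ⟨hi₁, hτi₁⟩, hmin₁⟩ :
              ∃ i₁, (i₁ < j ∧ τ j i₁ = 1) ∧ ∀ l < i₁, τ j l ≠ 1 := by
            have hex : ∃ i, i < j ∧ τ j i = 1 := by
              push Not at hfarj
              obtain ⟨i, hi⟩ := hfarj
              exact ⟨i, i.2, hi⟩
            refine ⟨Nat.find hex, Nat.find_spec hex, fun j hj h => Nat.find_min hex hj ⟨?_, h⟩⟩
            exact hj.trans (Nat.find_spec hex).1
          have hcl := (hs j hj).close ⟨i₁, hi₁⟩ hτi₁ (fun l hl => hmin₁ l hl) b hbLj hne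
          obtain ⟨q₁, hq₁⟩ : ∃ q₁, q₁ = (Finset.range i₁).filter fun l => τ j l = 3 := ⟨_, rfl⟩
          have hq₁i : q₁ ⊆ Finset.range i₁ := hq₁ ▸ Finset.filter_subset _ _
          dsimp only at hcl
          rw [← hq₁] at hcl
          have hi₁n := hi₁.trans hj
          have hKg₁ : b < (s i₁).M → (s i₁).H q₁ b = g b := fun h =>
            (hs i₁ hi₁n).H_eq q₁ hq₁i b h fun i => hb i (i.2.trans hi₁n)
          have hNM₁ := hNM i₁ hi₁n
          rcases lt_trichotomy i₁ i₀ with h | rfl | h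
          · have h1 := hrM i₁ i₀ h hi₀
            have h2 := hLr i₁ hi₁n
            have h3 := hML i₁ hi₁n
            have h4 := (hs i₁ hi₁n).tail q₁ hq₁i b
            omega
          · have h1 := hτ.triangle n i₁ j
            rw [hτ.symm i₁ j] at h1
            by_cases hqq : q₁ = q₀
            · subst hqq
              omega
            · have h2 := hst.cross q₁ hq₁i q₀ hq₀i hqq b
              omega
          · have h1 := hrM i₀ i₁ h hi₁n
            have h2 := hLr i₀ hi₀
            omega
    have hagree : ∀ a < (s i₀).L, f a = (s i₀).H q₀ a := fun a ha => by
      by_cases h : ∃ j < n, (s j).r = a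
      · obtain ⟨j, hj, rfl⟩ := h
        have hji : j < i₀ := by
          by_contra hji
          have := hLr i₀ hi₀
          rcases (not_lt.1 hji).eq_or_lt with rfl | h
          · omega
          · have := hrlt i₀ j h hj
            omega
        rw [hfr j hj, hKr j hji]
      · push Not at h
        exact hfK a h
    have hLL : (s i₀).L ≤ L := (hLr i₀ hi₀).trans (hrL i₀ hi₀).le
    obtain ⟨x, hx, hxf, hxc⟩ := hst.full q₀ hq₀i L hLL f hKatf hagree
    refine ⟨x, hx, hxc, fun j hj => (hxf _ (hrL j hj)).trans (hfr j hj),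
      fun h => absurd hτi₀ (h i₀ hi₀), fun i hi hτi hi' y hy hne => ?_⟩
    have : i = i₀ := by
      rcases lt_trichotomy i i₀ with h | h | h
      · exact absurd hτi (hmin i h)
      · exact h
      · exact absurd hτi₀ (hi' i₀ h)
    subst this
    rw [← hq₀]
    exact (hxf y hy).trans (hfK y hne)

/-- A finite colouring of the generic `{1, 2, 3}`-valued metric space has a monochromatic copy of
every countable metric space with distances in `{1, 2, 3}`. -/
theorem exists_monochromatic {k : ℕ} {D τ : ℕ → ℕ → ℕ} (hD : IsMetricThree D)
    (hext : ∀ f, IsKatetov D f → ∀ N, ∃ x ≥ N, ∀ a < N, D x a = f a) (hτ : IsMetricThree τ)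
    (χ : ℕ → Fin k) :
    ∃ c, ∃ r : ℕ → ℕ, (∀ i j, D (r i) (r j) = τ i j) ∧ ∀ i, χ (r i) = c := by
  obtain ⟨c, N₀, g, hg, hg2, hU⟩ := exists_uniform hD hext χ
  obtain ⟨s, hs⟩ := exists_seq_of_step (IsStage D τ χ c N₀ g)
    (exists_isStage hD hτ hg hg2 hU)
  refine ⟨c, fun i => (s i).r, fun i j => ?_, fun i => (hs i).color⟩
  rcases lt_trichotomy i j with h | rfl | h
  · rw [hD.symm, hτ.symm]
    exact (hs j).dist ⟨i, h⟩
  · rw [hD.self, hτ.self]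
  · exact (hs i).dist ⟨j, h⟩

/-- The sequence obtained from `h` by moving each term, in turn, by as little as possible so that
the result is `1`-Lipschitz for `d`. -/
def greedy (d : ℕ → ℕ → ℕ) (h : ℕ → ℕ) (l : ℕ) : ℕ :=
  max (Finset.univ.sup fun i : Fin l => greedy d h i - d i l)
    (h l - Finset.univ.sup fun i : Fin l => h l - (greedy d h i + d i l))
decreasing_by all_goals exact i.2

theorem greedy_congr (d : ℕ → ℕ → ℕ) {h h' : ℕ → ℕ} (l : ℕ) (H : ∀ i ≤ l, h i = h' i) :
    greedy d h l = greedy d h' l := by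
  induction l using Nat.strong_induction_on with
  | _ l ih =>
    have hi : ∀ i : Fin l, greedy d h i = greedy d h' i := fun i =>
      ih i i.2 fun j hj => H j (hj.trans i.2.le)
    rw [greedy, greedy]
    simp only [hi, H l le_rfl]

theorem greedy_le_or (d : ℕ → ℕ → ℕ) (h : ℕ → ℕ) (l : ℕ) :
    greedy d h l ≤ h l ∨ ∃ i < l, greedy d h l + d i l ≤ greedy d h i := by
  by_contra! hcon
  obtain ⟨h1, h2⟩ := hcon
  have h3 : (Finset.univ.sup fun i : Fin l => greedy d h i - d i l) < greedy d h l := by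
    rw [Finset.sup_lt_iff (by rw [Nat.bot_eq_zero]; omega)]
    intro i _
    have := h2 i i.2
    omega
  have h4 := greedy.eq_1 d h l
  omega

theorem le_greedy_or (d : ℕ → ℕ → ℕ) (h : ℕ → ℕ) (l : ℕ) :
    h l ≤ greedy d h l ∨ ∃ i < l, greedy d h i + d i l ≤ greedy d h l := by
  by_contra! hcon
  obtain ⟨h1, h2⟩ := hcon
  have h3 : h l - (Finset.univ.sup fun i : Fin l => h l - (greedy d h i + d i l)) ≤
      greedy d h l := by
    rw [greedy.eq_1 d h l]
    exact le_max_right _ _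
  have h4 : (Finset.univ.sup fun i : Fin l => h l - (greedy d h i + d i l)) <
      h l - greedy d h l := by
    rw [Finset.sup_lt_iff (by rw [Nat.bot_eq_zero]; omega)]
    intro i _
    have := h2 i i.2
    omega
  omega

theorem greedy_lipschitz {d : ℕ → ℕ → ℕ} (hsymm : ∀ i j, d i j = d j i)
    (htri : ∀ i j k, d i k ≤ d i j + d j k) (h : ℕ → ℕ) (l : ℕ) :
    ∀ i < l, greedy d h i ≤ greedy d h l + d i l ∧ greedy d h l ≤ greedy d h i + d i l := by
  induction l using Nat.strong_induction_on with
  | _ l ih =>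
    intro i hi
    rw [greedy.eq_1 d h l]
    refine ⟨?_, max_le (Finset.sup_le fun j _ => ?_) ?_⟩
    · have := Finset.le_sup (f := fun i : Fin l => greedy d h i - d i l)
        (Finset.mem_univ ⟨i, hi⟩)
      dsimp only at this
      omega
    · have := htri i l j
      have := htri j l i
      have := hsymm l i
      have := hsymm l j
      have := hsymm i j
      rcases lt_trichotomy i j with h1 | h1 | h1
      · have := ih j j.2 i h1
        omega
      · subst h1
        omega
      · have := ih i hi j h1
        omega
    · have := Finset.le_sup (f := fun i : Fin l => h l - (greedy d h i + d i l))
        (Finset.mem_univ ⟨i, hi⟩)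
      dsimp only at this
      omega

theorem greedy_near {d : ℕ → ℕ → ℕ} (htri : ∀ i j k, d i k ≤ d i j + d j k) {h : ℕ → ℕ} {ε : ℕ}
    (hh : ∀ i l, i < l → h i ≤ h l + d i l + ε ∧ h l ≤ h i + d i l + ε) (l : ℕ) :
    greedy d h l ≤ h l + ε ∧ h l ≤ greedy d h l + ε := by
  have hup : ∀ i < l, greedy d h l + d i l ≤ greedy d h i → greedy d h l ≤ h l + ε := by
    intro i
    induction i using Nat.strong_induction_on with
    | _ i ih =>
      intro hi hle
      rcases greedy_le_or d h i with h1 | ⟨j, hj, h1⟩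
      · have := hh i l hi
        omega
      · have := htri j i l
        exact ih j hj (hj.trans hi) (by omega)
  have hdown : ∀ i < l, greedy d h i + d i l ≤ greedy d h l → h l ≤ greedy d h l + ε := by
    intro i
    induction i using Nat.strong_induction_on with
    | _ i ih =>
      intro hi hle
      rcases le_greedy_or d h i with h1 | ⟨j, hj, h1⟩
      · have := hh i l hi
        omega
      · have := htri j i l
        exact ih j hj (hj.trans hi) (by omega)
  constructor
  · rcases greedy_le_or d h l with h1 | ⟨i, hi, h1⟩
    · omega
    · exact hup i hi h1
  · rcases le_greedy_or d h l with h1 | ⟨i, hi, h1⟩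
    · omega
    · exact hdown i hi h1

/-- The functions that are `1`-Lipschitz for `3 * D`. -/
abbrev LipThree (D : ℕ → ℕ → ℕ) : Type := {h : ℕ → ℕ // ∀ w w', h w ≤ h w' + 3 * D w w'}

instance (D : ℕ → ℕ → ℕ) : Nonempty (LipThree D) := ⟨⟨fun _ => 0, fun _ _ => Nat.zero_le _⟩⟩

/-- The value of `h` at a point of `ℕ ⊕ (ℕ × List ℕ)`: a left point is a point of the generic
space, and `inr (n, l)` is the `n`-th point of the greedy correction of `h` along `l`. -/
def greedyEval (d : ℕ → ℕ → ℕ) (h : ℕ → ℕ) : ℕ ⊕ (ℕ × List ℕ) → ℕ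
  | .inl w => h w
  | .inr (n, l) => greedy d (fun i => h (l.getD i 0)) n

/-- The pseudometric bounded by `m` induced by the evaluations of Lipschitz functions. -/
noncomputable def evalDist (m : ℕ) (d D : ℕ → ℕ → ℕ) (p q : ℕ ⊕ (ℕ × List ℕ)) : ℕ :=
  ⨆ h : LipThree D, min m (Nat.dist (greedyEval d h.1 p) (greedyEval d h.1 q))

theorem le_evalDist {m : ℕ} {d D : ℕ → ℕ → ℕ} (h : LipThree D) (p q : ℕ ⊕ (ℕ × List ℕ)) :
    min m (Nat.dist (greedyEval d h.1 p) (greedyEval d h.1 q)) ≤ evalDist m d D p q :=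
  le_ciSup (f := fun h : LipThree D =>
    min m (Nat.dist (greedyEval d h.1 p) (greedyEval d h.1 q)))
    ⟨m, by rintro _ ⟨h, rfl⟩; exact min_le_left _ _⟩ h

theorem evalDist_le {m : ℕ} {d D : ℕ → ℕ → ℕ} {p q : ℕ ⊕ (ℕ × List ℕ)} {B : ℕ}
    (hB : ∀ h : LipThree D, min m (Nat.dist (greedyEval d h.1 p) (greedyEval d h.1 q)) ≤ B) :
    evalDist m d D p q ≤ B :=
  ciSup_le hB

theorem evalDist_comm (m : ℕ) (d D : ℕ → ℕ → ℕ) (p q : ℕ ⊕ (ℕ × List ℕ)) :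
    evalDist m d D p q = evalDist m d D q p := by
  simp only [evalDist, Nat.dist_comm]

theorem evalDist_triangle (m : ℕ) (d D : ℕ → ℕ → ℕ) (p q t : ℕ ⊕ (ℕ × List ℕ)) :
    evalDist m d D p t ≤ evalDist m d D p q + evalDist m d D q t := by
  refine evalDist_le fun h => ?_
  have h1 := le_evalDist (m := m) (d := d) h p q
  have h2 := le_evalDist (m := m) (d := d) h q t
  simp only [Nat.dist] at h1 h2 ⊢
  omega

theorem evalDist_le_bound (m : ℕ) (d D : ℕ → ℕ → ℕ) (p q : ℕ ⊕ (ℕ × List ℕ)) :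
    evalDist m d D p q ≤ m :=
  evalDist_le fun _ => min_le_left _ _

/-- The `n`-th point of the greedy correction along the sequence `r`. -/
def greedyPoint (r : ℕ → ℕ) (n : ℕ) : ℕ ⊕ (ℕ × List ℕ) :=
  .inr (n, (List.range (n + 1)).map r)

theorem greedyEval_greedyPoint (d : ℕ → ℕ → ℕ) (h r : ℕ → ℕ) (n : ℕ) :
    greedyEval d h (greedyPoint r n) = greedy d (fun i => h (r i)) n := by
  refine greedy_congr d n fun i hi => ?_
  have : i < n + 1 := by omega
  simp [this]

theorem evalDist_greedyPoint_inl_le {m : ℕ} {d D : ℕ → ℕ → ℕ}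
    (htri : ∀ i j k, d i k ≤ d i j + d j k) {r : ℕ → ℕ}
    (hr : ∀ i j, 3 * D (r i) (r j) ≤ d i j + 2) (hD : ∀ w w', D w w' = D w' w) (n : ℕ) :
    evalDist m d D (greedyPoint r n) (.inl (r n)) ≤ 2 := by
  refine evalDist_le fun h => ?_
  rw [greedyEval_greedyPoint]
  have := greedy_near htri (h := fun i => h.1 (r i)) (ε := 2) (fun i l _ => by
    have := h.2 (r i) (r l)
    have := h.2 (r l) (r i)
    rw [hD (r l)] at this
    have := hr i l
    omega) n
  simp only [greedyEval, Nat.dist]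
  omega

theorem evalDist_greedyPoint {m : ℕ} {d D : ℕ → ℕ → ℕ} (hself : ∀ i, d i i = 0)
    (hsymm : ∀ i j, d i j = d j i) (htri : ∀ i j k, d i k ≤ d i j + d j k)
    (hm : ∀ i j, d i j ≤ m) (hD : IsMetricThree D) {r : ℕ → ℕ}
    (hr : ∀ i j, d i j ≤ 3 * D (r i) (r j)) (n k : ℕ) :
    evalDist m d D (greedyPoint r n) (greedyPoint r k) = d n k := by
  refine le_antisymm (evalDist_le fun h => min_le_of_right_le ?_) ?_
  · rw [greedyEval_greedyPoint, greedyEval_greedyPoint, Nat.dist]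
    rcases lt_trichotomy n k with h1 | rfl | h1
    · have := greedy_lipschitz hsymm htri (fun i => h.1 (r i)) k n h1
      omega
    · omega
    · have := greedy_lipschitz hsymm htri (fun i => h.1 (r i)) n k h1
      rw [hsymm k n] at this
      omega
  · have hle : ∀ w j, ⨅ i, (d i k + 3 * D (r i) w) ≤ d j k + 3 * D (r j) w := fun w j =>
      ciInf_le (OrderBot.bddBelow _) j
    have hmem : ∀ w, ∃ j, d j k + 3 * D (r j) w = ⨅ i, (d i k + 3 * D (r i) w) := fun w =>
      Nat.sInf_mem (Set.range_nonempty _)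
    let h : LipThree D := ⟨fun w => ⨅ i, (d i k + 3 * D (r i) w), fun w w' => by
      obtain ⟨j, hj⟩ := hmem w'
      have := hle w j
      have := hD.triangle (r j) w' w
      rw [hD.symm w' w] at this
      dsimp only
      omega⟩
    have hval : ∀ j, h.1 (r j) = d j k := fun j => by
      refine le_antisymm ?_ (le_ciInf fun i => ?_)
      · have := hle (r j) j
        rwa [hD.self, mul_zero, add_zero] at this
      · have := htri j i k
        have := hr i j
        rw [hsymm i j] at this
        omega
    have key : ∀ l, greedy d (fun i => h.1 (r i)) l = d l k := fun l => by
      have := greedy_near htri (h := fun i => h.1 (r i)) (ε := 0) (fun i l _ => by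
        have := htri i l k
        have := htri l i k
        rw [hsymm l i] at this
        simp only [hval]
        omega) l
      simp only [hval] at this ⊢
      omega
    have := le_evalDist (m := m) (d := d) h (greedyPoint r n) (greedyPoint r k)
    rw [greedyEval_greedyPoint, greedyEval_greedyPoint, key, key, hself, Nat.dist] at this
    have := hm n k
    omega

theorem IsUrysohnSphereM.exists_embedding {m : ℕ} (hm : 0 < m) {S : Type} [MetricSpace S]
    (hS : IsUrysohnSphereM m S) {V : Type} [Countable V] (ρ : V → V → ℕ)
    (hself : ∀ p, ρ p p = 0) (hpos : ∀ p q, p ≠ q → 0 < ρ p q) (hsymm : ∀ p q, ρ p q = ρ q p)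
    (htri : ∀ p q t, ρ p t ≤ ρ p q + ρ q t) (hle : ∀ p q, ρ p q ≤ m) :
    ∃ e : V → S, ∀ p q, dist (e p) (e q) = ρ p q / m := by
  have hm' : (0 : ℝ) < m := by exact_mod_cast hm
  let I : MetricSpace V :=
    { dist := fun p q => (ρ p q : ℝ) / m
      dist_self := fun p => by simp [hself]
      dist_comm := fun p q => by rw [hsymm]
      dist_triangle := fun p q t => by
        rw [← add_div]
        have : (ρ p t : ℝ) ≤ ρ p q + ρ q t := by exact_mod_cast htri p q t
        gcongr
      eq_of_dist_eq_zero := fun {p q} h => by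
        by_contra hne
        have h1 : (0 : ℝ) < ρ p q := by exact_mod_cast hpos p q hne
        exact (div_pos h1 hm').ne' h }
  obtain ⟨e, he⟩ := hS.2.2.2 V inferInstance fun p q => ⟨ρ p q, hle p q, rfl⟩
  exact ⟨e, fun p q => he.dist_eq p q⟩

theorem IsUrysohnSphereM.exists_enum {m : ℕ} (hm : 0 < m) {S : Type} [MetricSpace S]
    (hS : IsUrysohnSphereM m S) : Nonempty (ℕ ≃ S) := by
  obtain ⟨e, he⟩ := hS.exists_embedding hm (V := ℕ) (fun p q => if p = q then 0 else 1)
    (by simp) (fun p q h => by simp [h]) (fun p q => by simp only [eq_comm])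
    (fun p q t => by split_ifs <;> omega) (fun p q => by split_ifs <;> omega)
  have hinj : Function.Injective e := fun p q h => by
    by_contra hne
    have := he p q
    rw [h, dist_self, if_neg hne] at this
    have hm' : (0 : ℝ) < m := by exact_mod_cast hm
    have h1 : (0 : ℝ) < ((1 : ℕ) : ℝ) / m := by positivity
    exact h1.ne this
  have := hS.1
  have := Infinite.of_injective e hinj
  exact nonempty_equiv_of_countable

/-- For every `m ≤ 9`, `S_m` is `2/m`-indivisible. -/
theorem stmt14 (m : ℕ) (hm : 0 < m) (hm9 : m ≤ 9)
    (Sm : Type) [MetricSpace Sm] (hSm : IsUrysohnSphereM m Sm) :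
    EpsIndivisible Sm (2/(m:ℝ)) := by
  intro k _ χ
  have hm' : (0 : ℝ) < m := by exact_mod_cast hm
  obtain ⟨y⟩ := hSm.exists_enum hm
  choose δ hδm hδ using hSm.2.2.1
  have hδ_eq : ∀ a b, (δ a b : ℝ) = dist a b * m := fun a b => by
    rw [hδ, div_mul_cancel₀ _ hm'.ne']
  obtain ⟨d, hd⟩ : ∃ d : ℕ → ℕ → ℕ, d = fun i j => δ (y i) (y j) := ⟨_, rfl⟩
  have hd_dist : ∀ i j, dist (y i) (y j) = d i j / m := fun i j => by rw [hd]; exact hδ _ _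
  have hself : ∀ i, d i i = 0 := fun i => by
    have := hδ_eq (y i) (y i)
    rw [dist_self, zero_mul] at this
    rw [hd]
    exact_mod_cast this
  have hsymm : ∀ i j, d i j = d j i := fun i j => by
    have h1 := hδ_eq (y i) (y j)
    rw [dist_comm, ← hδ_eq] at h1
    rw [hd]
    exact_mod_cast h1
  have htri : ∀ i j l, d i l ≤ d i j + d j l := fun i j l => by
    have h : (δ (y i) (y l) : ℝ) ≤ δ (y i) (y j) + δ (y j) (y l) := by
      rw [hδ_eq, hδ_eq, hδ_eq, ← add_mul]
      gcongr
      exact dist_triangle _ _ _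
    rw [hd]
    exact_mod_cast h
  have hpos : ∀ i j, i ≠ j → 1 ≤ d i j := fun i j hij => by
    by_contra! h
    have h1 := hd_dist i j
    rw [Nat.lt_one_iff.1 h, Nat.cast_zero, zero_div, dist_eq_zero] at h1
    exact hij (y.injective h1)
  have hdm : ∀ i j, d i j ≤ m := fun i j => by rw [hd]; exact hδm _ _
  have hτ : IsMetricThree fun i j => (d i j + 2) / 3 :=
    { self := fun i => by simp [hself]
      symm := fun i j => by rw [hsymm]
      pos := fun i j hij => by have := hpos i j hij; omega
      le := fun i j => by have := hdm i j; omega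
      triangle := fun i j l => by have := htri i j l; omega }
  obtain ⟨D, hD, hext⟩ := exists_generic_metricThree
  obtain ⟨e, he⟩ := hSm.exists_embedding hm (V := ℕ ⊕ (ℕ × List ℕ))
    (fun p q => if p = q then 0 else max 1 (evalDist m d D p q)) (by simp)
    (fun p q h => by simp [h]) (fun p q => by simp only [eq_comm, evalDist_comm])
    (fun p q t => by
      have := evalDist_triangle m d D p q t
      by_cases h1 : p = q
      · subst h1
        simp
      by_cases h2 : q = t
      · subst h2
        simp
      rw [if_neg h1, if_neg h2]
      split_ifs <;> omega)
    (fun p q => by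
      have := evalDist_le_bound m d D p q
      split_ifs <;> omega)
  obtain ⟨c, r, hr, hc⟩ := exists_monochromatic hD hext hτ fun w => χ (e (.inl w))
  refine ⟨c, fun z => e (greedyPoint r (y.symm z)), Isometry.of_dist_eq fun z z' => ?_,
    fun z => ⟨e (.inl (r (y.symm z))), hc _, ?_⟩⟩
  · obtain ⟨i, rfl⟩ := y.surjective z
    obtain ⟨j, rfl⟩ := y.surjective z'
    simp only [Equiv.symm_apply_apply]
    rw [he, hd_dist, evalDist_greedyPoint hself hsymm htri hdm hD
      (fun i j => by rw [hr]; omega)]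
    by_cases hij : i = j
    · simp [hij, hself]
    · have hne : greedyPoint r i ≠ greedyPoint r j := fun h =>
        hij (Prod.mk.inj (Sum.inr.inj h)).1
      rw [if_neg hne, max_eq_right (hpos i j hij)]
  · have := evalDist_greedyPoint_inl_le (m := m) htri (r := r) (D := D)
      (fun i j => by rw [hr]; omega) hD.symm (y.symm z)
    rw [he, if_neg (by simp [greedyPoint])]
    have h2 : ((max 1 (evalDist m d D (greedyPoint r (y.symm z)) (.inl (r (y.symm z)))) : ℕ) : ℝ) ≤
        2 := by
      exact_mod_cast max_le one_le_two this
    gcongr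
end

section
/- Let m be a positive integer. If some (equivalently, every) countable ultrahomogeneous metric space S_m with all distances in [0,1]_m into which every countable metric space with distances in [0,1]_m embeds isometrically is (1/m)-indivisible, then every Urysohn sphere S is ε-indivisible for every ε ≥ 3/(2m). -/
open Metric

/-- `δ` is an integer-valued pseudometric on the natural numbers, bounded by `B`. -/
structure IsNatDist (δ : ℕ → ℕ → ℕ) (B : ℕ) : Prop where
  self : ∀ i, δ i i = 0
  comm : ∀ i j, δ i j = δ j i
  triangle : ∀ i j k, δ i k ≤ δ i j + δ j k
  le : ∀ i j, δ i j ≤ B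

/-- A code of stage `n` records a natural number (at most `C`) for each index `i ≤ n`, the last
of them being at most `H`. -/
def TypeCode (H C : ℕ) : Type :=
  {g : ℕ × (ℕ → ℕ) // g.2 g.1 ≤ H ∧ (∀ i, g.2 i ≤ C) ∧ ∀ i, g.1 < i → g.2 i = 0}

namespace TypeCode

variable {H C : ℕ}

/-- The stage of a code. -/
def stage (g : TypeCode H C) : ℕ := g.1.1

/-- The entries of a code. -/
def coord (g : TypeCode H C) : ℕ → ℕ := g.1.2

lemma coord_stage_le (g : TypeCode H C) : g.coord g.stage ≤ H := g.2.1

lemma coord_le (g : TypeCode H C) (i : ℕ) : g.coord i ≤ C := g.2.2.1 i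

/-- The code of stage `n` with entries prescribed by a function. -/
def mk (n : ℕ) (σ : ℕ → ℕ) (hn : σ n ≤ H) (hC : ∀ i, σ i ≤ C) : TypeCode H C :=
  ⟨(n, fun i => if i ≤ n then σ i else 0), by simpa using hn,
    fun i => by dsimp only; split_ifs <;> simp [hC],
    fun i hi => by simp only [ite_eq_right_iff]; intro h; omega⟩

lemma coord_mk {n : ℕ} {σ : ℕ → ℕ} {hn : σ n ≤ H} {hC : ∀ i, σ i ≤ C} {i : ℕ} (hi : i ≤ n) :
    (mk n σ hn hC).coord i = σ i := if_pos hi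

lemma finite_stage_le (w : ℕ) : Finite {g : TypeCode H C // g.stage ≤ w} := by
  refine Finite.of_injective (β := Fin (w + 1) × (Fin (w + 1) → Fin (C + 1)))
    (fun g => (⟨g.1.stage, Nat.lt_succ_of_le g.2⟩,
      fun i => ⟨g.1.coord i, Nat.lt_succ_of_le (g.1.coord_le i)⟩)) ?_
  rintro ⟨⟨⟨n, σ⟩, h₁⟩, hn⟩ ⟨⟨⟨n', σ'⟩, h₂⟩, hn'⟩ h
  simp only [stage, coord, Prod.mk.injEq, Fin.mk.injEq, funext_iff] at h hn hn'
  obtain ⟨rfl, h⟩ := h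
  have : σ = σ' := by
    funext i
    by_cases hi : i ≤ w
    · exact h ⟨i, Nat.lt_succ_of_le hi⟩
    · exact (h₁.2.2 i (by show n < i; omega)).trans (h₂.2.2 i (by show n < i; omega)).symm
  subst this
  rfl

instance : Countable (TypeCode H C) := by
  have : (Set.univ : Set (TypeCode H C)) = ⋃ w, {g | g.stage ≤ w} := by
    ext g
    simp only [Set.mem_univ, Set.mem_iUnion, Set.mem_ofPred_eq, true_iff]
    exact ⟨_, le_rfl⟩
  rw [← Set.countable_univ_iff, this]
  refine Set.countable_iUnion fun w => ?_
  have : Finite ({g : TypeCode H C | g.stage ≤ w} : Set _) := finite_stage_le (H := H) (C := C) w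
  exact (Set.toFinite {g : TypeCode H C | g.stage ≤ w}).countable

/-- `g` and `g'` are joined by a chain of total weight `n`; a link has weight `k ≥ 1` when the
common entries of its two ends differ by less than `k * (2 * H + 1)`. -/
inductive Chain : TypeCode H C → TypeCode H C → ℕ → Prop
  | refl (g : TypeCode H C) : Chain g g 0
  | step {g g' g'' : TypeCode H C} {n k : ℕ} (h : Chain g g' n) (hk : 1 ≤ k)
      (hL : ∀ i, i ≤ g'.stage → i ≤ g''.stage →
        g'.coord i < g''.coord i + k * (2 * H + 1) ∧
        g''.coord i < g'.coord i + k * (2 * H + 1)) : Chain g g'' (n + k)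

lemma Chain.trans {g g' g'' : TypeCode H C} {n n' : ℕ} (h : Chain g g' n)
    (h' : Chain g' g'' n') : Chain g g'' (n + n') := by
  induction h' with
  | refl => exact h
  | step _ hk hL ih => rw [← Nat.add_assoc]; exact ih.step hk hL

lemma Chain.of_link {g g' : TypeCode H C} {k : ℕ} (hk : 1 ≤ k)
    (hL : ∀ i, i ≤ g.stage → i ≤ g'.stage →
      g.coord i < g'.coord i + k * (2 * H + 1) ∧ g'.coord i < g.coord i + k * (2 * H + 1)) :
    Chain g g' k := by
  simpa using (Chain.refl g).step hk hL

lemma Chain.symm {g g' : TypeCode H C} {n : ℕ} (h : Chain g g' n) : Chain g' g n := by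
  induction h with
  | refl => exact .refl _
  | step _ hk hL ih =>
    rw [Nat.add_comm]
    exact (Chain.of_link hk fun i hi hi' => (hL i hi' hi).symm).trans ih

lemma Chain.eq_of_zero {g g' : TypeCode H C} {n : ℕ} (h : Chain g g' n) (hn : n = 0) :
    g = g' := by
  cases h with
  | refl => rfl
  | step _ hk _ => omega

lemma Chain.exists_coord_add_le {g g' : TypeCode H C} {n : ℕ} (h : Chain g g' n) :
    ∃ j, j ≤ g.stage ∧ j ≤ g'.stage ∧
      g.coord j + g'.coord j ≤ n * (2 * H + 1) + 2 * H ∧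
      ∀ i ≤ j, g.coord i ≤ g'.coord i + n * (2 * H + 1) ∧
        g'.coord i ≤ g.coord i + n * (2 * H + 1) := by
  induction h with
  | refl =>
    have := g.coord_stage_le
    exact ⟨g.stage, le_rfl, le_rfl, by omega, fun i _ => by omega⟩
  | @step g' g'' n k h hk hL ih =>
    obtain ⟨j, hj, hj', hsum, hdiff⟩ := ih
    simp only [Nat.add_mul]
    by_cases hjs : j ≤ g''.stage
    · refine ⟨j, hj, hjs, ?_, fun i hi => ?_⟩
      · have := hL j hj' hjs
        omega
      · have := hL i (hi.trans hj') (hi.trans hjs)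
        have := hdiff i hi
        omega
    · have hlt : g''.stage ≤ j := by omega
      refine ⟨g''.stage, hlt.trans hj, le_rfl, ?_, fun i hi => ?_⟩
      · have := hL _ (hlt.trans hj') le_rfl
        have := hdiff _ hlt
        have := g''.coord_stage_le
        omega
      · have := hL i ((hi.trans hlt).trans hj') hi
        have := hdiff i (hi.trans hlt)
        omega

lemma exists_chain (g g' : TypeCode H C) : ∃ n, Chain g g' n := by
  refine ⟨C + 1, Chain.of_link (by omega) fun i _ _ => ?_⟩
  have h₁ := g.coord_le i
  have h₂ := g'.coord_le i
  have h₃ : C + 1 ≤ (C + 1) * (2 * H + 1) := Nat.le_mul_of_pos_right _ (by omega)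
  omega

/-- The least weight of a chain joining two codes. -/
noncomputable def chainDist (g g' : TypeCode H C) : ℕ := sInf {n | Chain g g' n}

lemma chain_chainDist (g g' : TypeCode H C) : Chain g g' (chainDist g g') :=
  Nat.sInf_mem (s := {n | Chain g g' n}) (exists_chain g g')

lemma chainDist_le {g g' : TypeCode H C} {n : ℕ} (h : Chain g g' n) : chainDist g g' ≤ n :=
  Nat.sInf_le h

lemma chainDist_self (g : TypeCode H C) : chainDist g g = 0 :=
  Nat.le_zero.1 (chainDist_le (.refl g))

lemma chainDist_comm (g g' : TypeCode H C) : chainDist g g' = chainDist g' g :=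
  le_antisymm (chainDist_le (chain_chainDist g' g).symm) (chainDist_le (chain_chainDist g g').symm)

lemma chainDist_triangle (g g' g'' : TypeCode H C) :
    chainDist g g'' ≤ chainDist g g' + chainDist g' g'' :=
  chainDist_le ((chain_chainDist g g').trans (chain_chainDist g' g''))

lemma eq_of_chainDist_eq_zero {g g' : TypeCode H C} (h : chainDist g g' = 0) : g = g' :=
  (chain_chainDist g g').eq_of_zero h

/-- Codes form a metric space with distances in `{k / m : k ≤ m}`: the chain distance,
truncated at `m` and divided by `m`. -/
@[reducible] noncomputable def metricSpace (m : ℕ) (hm : 0 < m) : MetricSpace (TypeCode H C) where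
  dist g g' := ((min (chainDist g g') m : ℕ) : ℝ) / m
  dist_self g := by simp [chainDist_self]
  dist_comm g g' := by rw [chainDist_comm]
  dist_triangle g g' g'' := by
    have := chainDist_triangle g g' g''
    rw [← add_div]
    gcongr
    exact_mod_cast (by omega : min (chainDist g g'') m ≤
      min (chainDist g g') m + min (chainDist g' g'') m)
  eq_of_dist_eq_zero {g g'} h := by
    have hm' : (m : ℝ) ≠ 0 := by positivity
    rw [div_eq_zero_iff, or_iff_left hm', Nat.cast_eq_zero] at h
    exact eq_of_chainDist_eq_zero (by omega)

lemma exists_close {δ : ℕ → ℕ → ℕ} {B : ℕ} (hδ : IsNatDist δ B) (s : ℕ) : ∃ n, δ s n ≤ H :=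
  ⟨s, by simp [hδ.self]⟩

section Code

variable {δ : ℕ → ℕ → ℕ} {B : ℕ} (hδ : IsNatDist δ B) (hBC : B + H ≤ C)

open Classical in
/-- The code of the index `s`: its stage is the first `n` at distance at most `H` from `s`, its
entries are the distances from `s` to the indices `i ≤ n`. -/
noncomputable def code (s : ℕ) : TypeCode H C :=
  mk (Nat.find (exists_close (H := H) hδ s)) (δ s) (Nat.find_spec (exists_close hδ s))
    fun i => by have := hδ.le s i; omega

lemma stage_code_le {s w : ℕ} (h : δ s w ≤ H) : (code hδ hBC s).stage ≤ w := by
  classical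
  exact Nat.find_min' (exists_close hδ s) h

lemma coord_code {s i : ℕ} (hi : i ≤ (code hδ hBC s).stage) : (code hδ hBC s).coord i = δ s i :=
  coord_mk hi

lemma chainDist_code_mk_le {s w k : ℕ} {σ : ℕ → ℕ} {hw : σ w ≤ H} {hC : ∀ i, σ i ≤ C}
    (hk : 1 ≤ k)
    (h : ∀ i, δ s i < σ i + k * (2 * H + 1) ∧ σ i < δ s i + k * (2 * H + 1)) :
    chainDist (code hδ hBC s) (mk w σ hw hC) ≤ k := by
  refine chainDist_le (Chain.of_link hk fun i hi hi' => ?_)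
  rw [coord_code hδ hBC hi, coord_mk (show i ≤ w from hi')]
  exact h i

lemma le_chainDist_code_mk {s w u : ℕ} {σ : ℕ → ℕ} {hw : σ w ≤ H} {hC : ∀ i, σ i ≤ C}
    (h : ∀ i, u ≤ δ s i + σ i) :
    u ≤ chainDist (code hδ hBC s) (mk w σ hw hC) * (2 * H + 1) + 2 * H := by
  obtain ⟨j, hj, hj', hsum, -⟩ :=
    (chain_chainDist (code hδ hBC s) (mk w σ hw hC)).exists_coord_add_le
  rw [coord_code hδ hBC hj, coord_mk (show j ≤ w from hj')] at hsum
  exact (h j).trans hsum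

lemma chainDist_code_le (s t w : ℕ) :
    chainDist (code hδ hBC s) (code hδ hBC t) * (2 * H + 1) ≤ δ s w + δ t w + (2 * H + 1) := by
  have hdm := Nat.div_add_mod' (δ s w + δ t w) (2 * H + 1)
  have hlt := Nat.mod_lt (δ s w + δ t w) (show 2 * H + 1 > 0 by omega)
  have : chainDist (code hδ hBC s) (code hδ hBC t) ≤ (δ s w + δ t w) / (2 * H + 1) + 1 := by
    refine chainDist_le (Chain.of_link (Nat.le_add_left 1 _) fun i hi hi' => ?_)
    rw [coord_code hδ hBC hi, coord_code hδ hBC hi', Nat.add_mul]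
    have h₁ := hδ.triangle s w i
    have h₂ := hδ.triangle t w i
    have h₃ := hδ.triangle w t i
    have h₄ := hδ.triangle w s i
    rw [hδ.comm w t] at h₃
    rw [hδ.comm w s] at h₄
    omega
  have := Nat.mul_le_mul_right (2 * H + 1) this
  rw [Nat.add_mul] at this
  omega

lemma le_chainDist_code (s t : ℕ) :
    δ s t ≤ chainDist (code hδ hBC s) (code hδ hBC t) * (2 * H + 1) + 2 * H := by
  obtain ⟨j, hj, hj', hsum, -⟩ :=
    (chain_chainDist (code hδ hBC s) (code hδ hBC t)).exists_coord_add_le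
  rw [coord_code hδ hBC hj, coord_code hδ hBC hj'] at hsum
  have := hδ.triangle s j t
  rw [hδ.comm j t] at this
  omega

lemma exists_chainDist_add_le_of_mod_le {s t w : ℕ} (hs : H < δ s w)
    (hab : δ s w % (2 * H + 1) + δ t w % (2 * H + 1) < 2 * H)
    (hle : δ s w % (2 * H + 1) ≤ δ t w % (2 * H + 1)) :
    ∃ c : TypeCode H C, c.stage ≤ w ∧
      (chainDist (code hδ hBC s) c + chainDist (code hδ hBC t) c) * (2 * H + 1) ≤
        δ s w + δ t w + (2 * H + 1) := by
  have ha := Nat.div_add_mod' (δ s w) (2 * H + 1)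
  have hb := Nat.div_add_mod' (δ t w) (2 * H + 1)
  set A := δ s w / (2 * H + 1)
  set a := δ s w % (2 * H + 1)
  set A' := δ t w / (2 * H + 1)
  set b := δ t w % (2 * H + 1)
  have hA : 1 ≤ A := by
    by_contra hA
    have : A = 0 := Nat.lt_one_iff.1 (not_le.1 hA)
    simp [this] at ha
    omega
  let σ : ℕ → ℕ := fun i => max (δ s i - (δ s w - (a + 1))) (δ t i - (δ t w + (a + 1)))
  have hσw : σ w ≤ H := by simp only [σ]; omega
  have hσC : ∀ i, σ i ≤ C := fun i => by
    have := hδ.le s i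
    have := hδ.le t i
    simp only [σ]; omega
  have key : ∀ i, δ s i ≤ δ t i + δ s w + δ t w ∧ δ t i ≤ δ s i + δ s w + δ t w := fun i => by
    have h₁ := hδ.triangle s w i
    have h₂ := hδ.triangle t w i
    have h₃ := hδ.triangle w t i
    have h₄ := hδ.triangle w s i
    rw [hδ.comm w t] at h₃
    rw [hδ.comm w s] at h₄
    omega
  have h₁ : chainDist (code hδ hBC s) (mk w σ hσw hσC) ≤ A := by
    refine chainDist_code_mk_le hδ hBC hA fun i => ?_
    have := key i
    have : 2 * H + 1 ≤ A * (2 * H + 1) := Nat.le_mul_of_pos_left _ (by omega)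
    simp only [σ]; omega
  have h₂ : chainDist (code hδ hBC t) (mk w σ hσw hσC) ≤ A' + 1 := by
    refine chainDist_code_mk_le hδ hBC (Nat.le_add_left 1 _) fun i => ?_
    have := key i
    simp only [σ, Nat.add_mul]; omega
  refine ⟨_, le_rfl, (Nat.mul_le_mul_right _ (Nat.add_le_add h₁ h₂)).trans ?_⟩
  simp only [Nat.add_mul]; omega

lemma exists_chainDist_add_le (s t w : ℕ) :
    ∃ c : TypeCode H C, c.stage ≤ w ∧
      (chainDist (code hδ hBC s) c + chainDist (code hδ hBC t) c) * (2 * H + 1) ≤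
        δ s w + δ t w + (2 * H + 1) + 1 := by
  by_cases hsw : (code hδ hBC s).stage ≤ w
  · refine ⟨code hδ hBC s, hsw, ?_⟩
    rw [chainDist_self, zero_add]
    have := chainDist_code_le hδ hBC t s w
    omega
  by_cases htw : (code hδ hBC t).stage ≤ w
  · refine ⟨code hδ hBC t, htw, ?_⟩
    rw [chainDist_self, add_zero]
    have := chainDist_code_le hδ hBC s t w
    omega
  have hs : H < δ s w := not_le.1 fun h => hsw (stage_code_le hδ hBC h)
  have ht : H < δ t w := not_le.1 fun h => htw (stage_code_le hδ hBC h)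
  by_cases hab : δ s w % (2 * H + 1) + δ t w % (2 * H + 1) < 2 * H
  · rcases le_total (δ s w % (2 * H + 1)) (δ t w % (2 * H + 1)) with hle | hle
    · obtain ⟨c, hc, h⟩ :=
        exists_chainDist_add_le_of_mod_le hδ hBC hs hab hle
      exact ⟨c, hc, h.trans (Nat.le_succ _)⟩
    · obtain ⟨c, hc, h⟩ :=
        exists_chainDist_add_le_of_mod_le hδ hBC ht (by omega) hle
      exact ⟨c, hc, by rw [Nat.add_comm (chainDist _ _)]; omega⟩
  · have ha := Nat.div_add_mod' (δ s w) (2 * H + 1)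
    have hb := Nat.div_add_mod' (δ t w) (2 * H + 1)
    have ha' := Nat.mod_lt (δ s w) (show 2 * H + 1 > 0 by omega)
    have hb' := Nat.mod_lt (δ t w) (show 2 * H + 1 > 0 by omega)
    have hC : ∀ i, δ w i ≤ C := fun i => by have := hδ.le w i; omega
    have key : ∀ u, chainDist (code hδ hBC u) (mk w (δ w) (by simp [hδ.self]) hC) ≤
        δ u w / (2 * H + 1) + 1 := fun u => by
      refine chainDist_code_mk_le hδ hBC (Nat.le_add_left 1 _) fun i => ?_
      have h₁ := hδ.triangle u w i
      have h₂ := hδ.triangle w u i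
      have := Nat.div_add_mod' (δ u w) (2 * H + 1)
      have := Nat.mod_lt (δ u w) (show 2 * H + 1 > 0 by omega)
      rw [hδ.comm w u] at h₂
      simp only [Nat.add_mul]; omega
    refine ⟨_, le_rfl, (Nat.mul_le_mul_right _ (Nat.add_le_add (key s) (key t))).trans ?_⟩
    simp only [Nat.add_mul]; omega

lemma exists_le_chainDist_sub {m : ℕ} (hBm : B ≤ m * (2 * H + 1) + H) {s t w : ℕ}
    (ht : H < δ t w) (hst : δ t w ≤ δ s w) :
    ∃ c : TypeCode H C, c.stage ≤ w ∧
      δ s w + min (chainDist (code hδ hBC t) c) m * (2 * H + 1) ≤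
        δ t w + (2 * H + 1) + min (chainDist (code hδ hBC s) c) m * (2 * H + 1) := by
  have ha := Nat.div_add_mod' (δ s w) (2 * H + 1)
  have hb := Nat.div_add_mod' (δ t w) (2 * H + 1)
  have ha' := Nat.mod_lt (δ s w) (show 2 * H + 1 > 0 by omega)
  have hb' := Nat.mod_lt (δ t w) (show 2 * H + 1 > 0 by omega)
  set A := δ s w / (2 * H + 1)
  set a := δ s w % (2 * H + 1)
  set A' := δ t w / (2 * H + 1)
  set b := δ t w % (2 * H + 1)
  have hsB := hδ.le s w
  have lower : ∀ {k c : ℕ}, k * (2 * H + 1) ≤ c * (2 * H + 1) + 2 * H → k ≤ c := by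
    intro k c h
    by_contra hlt
    have := Nat.mul_le_mul_right (2 * H + 1) (show c + 1 ≤ k by omega)
    rw [Nat.add_mul] at this
    omega
  have hAm : A ≤ m := lower (by omega)
  have finish : ∀ {c : TypeCode H C} {p q : ℕ}, chainDist (code hδ hBC t) c ≤ p →
      q ≤ chainDist (code hδ hBC s) c →
      q ≤ m → δ s w + p * (2 * H + 1) ≤ δ t w + (2 * H + 1) + q * (2 * H + 1) →
      δ s w + min (chainDist (code hδ hBC t) c) m * (2 * H + 1) ≤
        δ t w + (2 * H + 1) + min (chainDist (code hδ hBC s) c) m * (2 * H + 1) := by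
    intro c p q hp hq hqm h
    have h₁ := Nat.mul_le_mul_right (2 * H + 1)
      (show min (chainDist (code hδ hBC t) c) m ≤ p by omega)
    have h₂ := Nat.mul_le_mul_right (2 * H + 1)
      (show q ≤ min (chainDist (code hδ hBC s) c) m by omega)
    omega
  have tri₁ : ∀ i, δ t i ≤ δ t w + δ w i ∧ δ w i ≤ δ t w + δ t i := fun i =>
    ⟨hδ.triangle t w i, by rw [hδ.comm t w]; exact hδ.triangle w t i⟩
  have tri₂ : ∀ i, δ s w ≤ δ s i + δ w i := fun i => by rw [hδ.comm w i]; exact hδ.triangle s i w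
  by_cases hab : a ≤ b
  · have hC : ∀ i, δ w i ≤ C := fun i => by have := hδ.le w i; omega
    refine ⟨mk w (δ w) (by simp [hδ.self]) hC, le_rfl, finish (p := A' + 1) (q := A) ?_ ?_ hAm ?_⟩
    · refine chainDist_code_mk_le hδ hBC (Nat.le_add_left 1 _) fun i => ?_
      have := tri₁ i
      simp only [Nat.add_mul]; omega
    · refine lower (le_trans ?_ (le_chainDist_code_mk hδ hBC (u := δ s w) tri₂))
      omega
    · simp only [Nat.add_mul]; omega
  by_cases ha2 : H < a
  · have hC : ∀ i, δ w i + (2 * H + 1 - a) ≤ C := fun i => by have := hδ.le w i; omega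
    refine ⟨mk w (fun i => δ w i + (2 * H + 1 - a)) (by simp only [hδ.self]; omega) hC, le_rfl,
      finish (p := A' + 1) (q := A + 1) ?_ ?_ ?_ ?_⟩
    · refine chainDist_code_mk_le hδ hBC (Nat.le_add_left 1 _) fun i => ?_
      have := tri₁ i
      simp only [Nat.add_mul]; omega
    · refine lower (le_trans ?_ (le_chainDist_code_mk hδ hBC
        (u := δ s w + (2 * H + 1 - a)) fun i => ?_))
      · rw [Nat.add_mul]; omega
      · have := tri₂ i
        omega
    · have : A ≠ m := by rintro rfl; omega
      omega
    · simp only [Nat.add_mul]; omega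
  · have hA' : 1 ≤ A' := by
      by_contra h
      have : A' = 0 := Nat.lt_one_iff.1 (not_le.1 h)
      simp [this] at hb
      omega
    have hle : 2 * H + 1 ≤ A' * (2 * H + 1) := Nat.le_mul_of_pos_left _ (by omega)
    let σ : ℕ → ℕ := fun i => min (δ w i + (b + 1)) (δ t i + (δ t w - (b + 1)))
    have hσw : σ w ≤ H := by simp only [σ, hδ.self]; omega
    have hσC : ∀ i, σ i ≤ C := fun i => by have := hδ.le w i; simp only [σ]; omega
    refine ⟨mk w σ hσw hσC, le_rfl, finish (p := A') (q := A) ?_ ?_ hAm ?_⟩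
    · refine chainDist_code_mk_le hδ hBC hA' fun i => ?_
      have := tri₁ i
      simp only [σ]; omega
    · refine lower (le_trans ?_ (le_chainDist_code_mk hδ hBC
        (u := δ s w - (b + 1)) fun i => ?_))
      · omega
      · have := tri₁ i
        have := tri₂ i
        simp only [σ]; omega
    · omega

lemma exists_abs_sub_le {m : ℕ} (hBm : B ≤ m * (2 * H + 1) + H) (s t w : ℕ) :
    ∃ c : TypeCode H C, c.stage ≤ w ∧
      |(δ s w : ℤ) - δ t w| ≤ (2 * H + 1) +
        |(min (chainDist (code hδ hBC s) c) m : ℤ) - (min (chainDist (code hδ hBC t) c) m : ℤ)| *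
          (2 * H + 1) := by
  have direct : |(δ s w : ℤ) - δ t w| ≤
      (2 * H + 1) + (min (chainDist (code hδ hBC s) (code hδ hBC t)) m : ℤ) * (2 * H + 1) := by
    have h₁ := le_chainDist_code hδ hBC s t
    have h₂ := hδ.triangle s t w
    have h₃ := hδ.triangle t s w
    have h₄ := hδ.le s t
    rw [hδ.comm t s] at h₃
    have : δ s t ≤ (2 * H + 1) + min (chainDist (code hδ hBC s) (code hδ hBC t)) m *
        (2 * H + 1) := by
      rcases min_choice (chainDist (code hδ hBC s) (code hδ hBC t)) m with h | h <;>
        rw [h] <;> omega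
    zify at this h₂ h₃
    rw [abs_le]
    constructor <;> linarith
  by_cases hsw : (code hδ hBC s).stage ≤ w
  · refine ⟨code hδ hBC s, hsw, direct.trans_eq ?_⟩
    rw [chainDist_self, chainDist_comm (code hδ hBC t), ← Nat.cast_min, ← Nat.cast_min]
    simp
    exact .inl (abs_of_nonneg (le_min (by positivity) (by positivity))).symm
  by_cases htw : (code hδ hBC t).stage ≤ w
  · refine ⟨code hδ hBC t, htw, direct.trans_eq ?_⟩
    rw [chainDist_self, ← Nat.cast_min, ← Nat.cast_min]
    simp
    exact .inl (abs_of_nonneg (le_min (by positivity) (by positivity))).symm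
  have hs : H < δ s w := not_le.1 fun h => hsw (stage_code_le hδ hBC h)
  have ht : H < δ t w := not_le.1 fun h => htw (stage_code_le hδ hBC h)
  rcases le_total (δ t w) (δ s w) with hle | hle
  · obtain ⟨c, hc, h⟩ := exists_le_chainDist_sub hδ hBC hBm ht hle
    refine ⟨c, hc, ?_⟩
    zify at h hle
    rw [abs_of_nonneg (by linarith)]
    have := mul_le_mul_of_nonneg_right
      (le_abs_self ((min (chainDist (code hδ hBC s) c) m : ℤ) -
        (min (chainDist (code hδ hBC t) c) m : ℤ)))
      (show (0 : ℤ) ≤ 2 * H + 1 by positivity)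
    linarith
  · obtain ⟨c, hc, h⟩ := exists_le_chainDist_sub hδ hBC hBm hs hle
    refine ⟨c, hc, ?_⟩
    zify at h hle
    rw [abs_of_nonpos (by linarith)]
    have := mul_le_mul_of_nonneg_right
      (neg_le_abs ((min (chainDist (code hδ hBC s) c) m : ℤ) -
        (min (chainDist (code hδ hBC t) c) m : ℤ)))
      (show (0 : ℤ) ≤ 2 * H + 1 by positivity)
    linarith

end Code

end TypeCode

/-- Two points at distance `dM` of a space `M`, indices at distance `d`, and prescribed
distances `ρ s c` from the index `s` to points labelled by `c : G`, where every label has a stage.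
The last two fields are amalgamation conditions up to an error of `2 * r`, witnessed by labels
of small stage. -/
structure StagedData (M G : Type) where
  dM : M → M → ℝ
  d : ℕ → ℕ → ℝ
  ρ : ℕ → G → ℝ
  stage : G → ℕ
  r : ℝ
  dM_self : ∀ x, dM x x = 0
  dM_comm : ∀ x y, dM x y = dM y x
  dM_triangle : ∀ x y z, dM x z ≤ dM x y + dM y z
  dM_nonneg : ∀ x y, 0 ≤ dM x y
  dM_le_one : ∀ x y, dM x y ≤ 1
  d_self : ∀ i, d i i = 0
  d_comm : ∀ i j, d i j = d j i
  d_triangle : ∀ i j k, d i k ≤ d i j + d j k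
  d_nonneg : ∀ i j, 0 ≤ d i j
  d_le_one : ∀ i j, d i j ≤ 1
  ρ_nonneg : ∀ s c, 0 ≤ ρ s c
  ρ_le_one : ∀ s c, ρ s c ≤ 1
  r_nonneg : 0 ≤ r
  exists_add_le : ∀ s t w, ∃ c, stage c ≤ w ∧ ρ s c + ρ t c ≤ 2 * r + d s w + d t w
  exists_abs_sub_le : ∀ s t w, ∃ c, stage c ≤ w ∧ |d s w - d t w| ≤ 2 * r + |ρ s c - ρ t c|

namespace StagedData

variable {M G : Type} (X : StagedData M G)

/-- How far the point `x` is from realizing the distances `ρ s` to the points `φ c`, with `c` of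
stage at most `k`. -/
noncomputable def defect (k : ℕ) (φ : G → M) (x : M) (s : ℕ) : ℝ :=
  ⨆ c : {c // X.stage c ≤ k}, |X.dM x (φ c) - X.ρ s c|

lemma abs_sub_le_defect {k : ℕ} (φ : G → M) (x : M) (s : ℕ) {c : G} (hc : X.stage c ≤ k) :
    |X.dM x (φ c) - X.ρ s c| ≤ X.defect k φ x s := by
  refine le_ciSup (f := fun c : {c // X.stage c ≤ k} => |X.dM x (φ c) - X.ρ s c|)
    ⟨1, ?_⟩ ⟨c, hc⟩
  rintro _ ⟨c, rfl⟩
  have h₁ := X.dM_nonneg x (φ c)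
  have h₂ := X.dM_le_one x (φ c)
  have h₃ := X.ρ_nonneg s c
  have h₄ := X.ρ_le_one s c
  exact abs_le.2 ⟨by linarith, by linarith⟩

lemma defect_nonneg (k : ℕ) (φ : G → M) (x : M) (s : ℕ) : 0 ≤ X.defect k φ x s :=
  Real.iSup_nonneg fun _ => abs_nonneg _

lemma defect_le {k : ℕ} {φ : G → M} {x : M} {s : ℕ} {a : ℝ} (ha : 0 ≤ a)
    (h : ∀ c, X.stage c ≤ k → |X.dM x (φ c) - X.ρ s c| ≤ a) : X.defect k φ x s ≤ a :=
  Real.iSup_le (fun c => h c c.2) ha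

lemma defect_mono {k l : ℕ} (hkl : k ≤ l) (φ : G → M) (x : M) (s : ℕ) :
    X.defect k φ x s ≤ X.defect l φ x s :=
  X.defect_le (X.defect_nonneg l φ x s) fun _ hc => X.abs_sub_le_defect φ x s (hc.trans hkl)

lemma defect_le_add (k : ℕ) (φ : G → M) (x x' : M) (s : ℕ) :
    X.defect k φ x s ≤ X.defect k φ x' s + X.dM x x' := by
  refine X.defect_le (add_nonneg (X.defect_nonneg ..) (X.dM_nonneg ..)) fun c hc => ?_
  have h := abs_le.1 (X.abs_sub_le_defect φ x' s hc)
  have h₁ := X.dM_triangle x x' (φ c)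
  have h₂ := X.dM_triangle x' x (φ c)
  rw [X.dM_comm x' x] at h₂
  exact abs_le.2 ⟨by linarith, by linarith⟩

lemma defect_congr {k : ℕ} {φ ψ : G → M} (h : ∀ c, X.stage c ≤ k → φ c = ψ c) (x : M) (s : ℕ) :
    X.defect k φ x s = X.defect k ψ x s :=
  iSup_congr fun c => by rw [h c c.2]

open Classical in
/-- The cost of going from `(w, φ)` to `x` through `(k, φ)` and `(s, φ)`. -/
noncomputable def cost (p : ℕ × (G → M)) (x : M) (i : ℕ × ℕ) : ℝ :=
  if i.1 ≤ p.1 then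
    min 1 (X.d p.1 i.1 + X.d i.1 i.2 + X.r + X.defect i.1 p.2 x i.2) else 1

lemma cost_nonneg (p : ℕ × (G → M)) (x : M) (i : ℕ × ℕ) : 0 ≤ X.cost p x i := by
  have h₁ := X.d_nonneg p.1 i.1
  have h₂ := X.d_nonneg i.1 i.2
  have h₃ := X.r_nonneg
  have h₄ := X.defect_nonneg i.1 p.2 x i.2
  unfold cost
  split_ifs
  · exact le_min zero_le_one (by linarith)
  · exact zero_le_one

lemma cost_le_one (p : ℕ × (G → M)) (x : M) (i : ℕ × ℕ) : X.cost p x i ≤ 1 := by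
  unfold cost
  split_ifs
  · exact min_le_left _ _
  · exact le_rfl

lemma cost_le {w : ℕ} {k s : ℕ} (hk : k ≤ w) (φ : G → M) (x : M) :
    X.cost (w, φ) x (k, s) ≤ X.d w k + X.d k s + X.r + X.defect k φ x s := by
  rw [cost, if_pos hk]
  exact min_le_right _ _

lemma cost_eq_one_or (w : ℕ) (φ : G → M) (x : M) (k s : ℕ) :
    X.cost (w, φ) x (k, s) = 1 ∨
      k ≤ w ∧ X.cost (w, φ) x (k, s) = X.d w k + X.d k s + X.r + X.defect k φ x s := by
  unfold cost
  split_ifs with h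
  · rcases min_choice 1 (X.d w k + X.d k s + X.r + X.defect k φ x s) with h' | h'
    · exact .inl h'
    · exact .inr ⟨h, h'⟩
  · exact .inl rfl

/-- The distance from the new point `(w, φ)` to the point `x` of `M`. -/
noncomputable def cross (p : ℕ × (G → M)) (x : M) : ℝ := ⨅ i, X.cost p x i

lemma cross_le_cost (p : ℕ × (G → M)) (x : M) (i : ℕ × ℕ) : X.cross p x ≤ X.cost p x i :=
  ciInf_le ⟨0, by rintro _ ⟨i, rfl⟩; exact X.cost_nonneg p x i⟩ i

lemma cross_le {w : ℕ} {k : ℕ} (hk : k ≤ w) (s : ℕ) (φ : G → M) (x : M) :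
    X.cross (w, φ) x ≤ X.d w k + X.d k s + X.r + X.defect k φ x s :=
  (X.cross_le_cost _ x (k, s)).trans (X.cost_le hk φ x)

lemma cross_nonneg (p : ℕ × (G → M)) (x : M) : 0 ≤ X.cross p x :=
  Real.iInf_nonneg (X.cost_nonneg p x)

lemma cross_le_one (p : ℕ × (G → M)) (x : M) : X.cross p x ≤ 1 :=
  (X.cross_le_cost p x (0, 0)).trans (X.cost_le_one _ _ _)

lemma le_cross {w : ℕ} {φ : G → M} {x : M} {a : ℝ} (ha : a ≤ 1)
    (h : ∀ k s, k ≤ w → a ≤ X.d w k + X.d k s + X.r + X.defect k φ x s) :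
    a ≤ X.cross (w, φ) x := by
  refine le_ciInf fun i => ?_
  rcases X.cost_eq_one_or w φ x i.1 i.2 with hi | ⟨hi, hi'⟩
  · exact ha.trans_eq hi.symm
  · exact (h _ _ hi).trans_eq hi'.symm

lemma le_cross_add_cross {u v : ℕ} {φ ψ : G → M} {x x' : M} {a : ℝ} (ha : a ≤ 1)
    (h : ∀ k s l t, k ≤ u → l ≤ v →
      a ≤ (X.d u k + X.d k s + X.r + X.defect k φ x s) +
        (X.d v l + X.d l t + X.r + X.defect l ψ x' t)) :
    a ≤ X.cross (u, φ) x + X.cross (v, ψ) x' := by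
  refine le_ciInf_add_ciInf fun i j => ?_
  have h₁ := X.cost_nonneg (u, φ) x i
  have h₂ := X.cost_nonneg (v, ψ) x' j
  rcases X.cost_eq_one_or u φ x i.1 i.2 with hi | ⟨hi, hi'⟩
  · exact ha.trans (by rw [hi]; linarith)
  rcases X.cost_eq_one_or v ψ x' j.1 j.2 with hj | ⟨hj, hj'⟩
  · exact ha.trans (by rw [hj]; linarith)
  · exact (h _ _ _ _ hi hj).trans_eq (by rw [hi', hj'])

lemma cross_le_add_dM (p : ℕ × (G → M)) (x x' : M) :
    X.cross p x ≤ X.cross p x' + X.dM x x' := by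
  rw [← sub_le_iff_le_add]
  refine X.le_cross (by linarith [X.cross_le_one p x, X.dM_nonneg x x']) fun k s hk => ?_
  linarith [X.cross_le hk s p.2 x, X.defect_le_add k p.2 x x' s]

lemma dM_le_cross_add_cross (p : ℕ × (G → M)) (x x' : M) :
    X.dM x x' ≤ X.cross p x + X.cross p x' := by
  obtain ⟨w, φ⟩ := p
  have key : ∀ (x x' : M) (k s l t : ℕ), k ≤ l →
      X.dM x x' ≤ (X.d w k + X.d k s + X.r + X.defect k φ x s) +
        (X.d w l + X.d l t + X.r + X.defect l φ x' t) := by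
    intro x x' k s l t hkl
    obtain ⟨c, hc, h⟩ := X.exists_add_le s t k
    have h₁ := abs_le.1 (X.abs_sub_le_defect φ x s hc)
    have h₂ := abs_le.1 (X.abs_sub_le_defect φ x' t (hc.trans hkl))
    have h₃ := X.dM_triangle x (φ c) x'
    have h₄ := X.d_triangle t l k
    have h₅ := X.d_triangle l w k
    rw [X.dM_comm (φ c) x'] at h₃
    rw [X.d_comm t l] at h₄
    rw [X.d_comm l w] at h₅
    rw [X.d_comm s k] at h
    linarith
  refine X.le_cross_add_cross (X.dM_le_one x x') fun k s l t _ _ => ?_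
  rcases le_total k l with hkl | hkl
  · exact key x x' k s l t hkl
  · rw [X.dM_comm, add_comm]
    exact key x' x l t k s hkl

lemma d_le_cross_add_cross (u v : ℕ) (φ : G → M) (x : M) :
    X.d u v ≤ X.cross (u, φ) x + X.cross (v, φ) x := by
  have key : ∀ (u v k s l t : ℕ), k ≤ l →
      X.d u v ≤ (X.d u k + X.d k s + X.r + X.defect k φ x s) +
        (X.d v l + X.d l t + X.r + X.defect l φ x t) := by
    intro u v k s l t hkl
    obtain ⟨c, hc, h⟩ := X.exists_abs_sub_le s t k
    have h₁ := abs_le.1 (X.abs_sub_le_defect φ x s hc)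
    have h₂ := abs_le.1 (X.abs_sub_le_defect φ x t (hc.trans hkl))
    have h₃ : |X.ρ s c - X.ρ t c| ≤ X.defect k φ x s + X.defect l φ x t :=
      abs_le.2 ⟨by linarith, by linarith⟩
    have h₄ := neg_le_of_abs_le (h.trans (add_le_add_right h₃ _))
    have h₅ := X.d_triangle u k v
    have h₆ := X.d_triangle k l v
    have h₇ := X.d_triangle k t l
    rw [X.d_comm l v] at h₆
    rw [X.d_comm k t, X.d_comm t l] at h₇
    rw [X.d_comm s k] at h₄
    linarith
  refine X.le_cross_add_cross (X.d_le_one u v) fun k s l t _ _ => ?_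
  rcases le_total k l with hkl | hkl
  · exact key u v k s l t hkl
  · rw [X.d_comm, add_comm]
    exact key v u l t k s hkl

lemma cross_le_add_d_of_le {n u : ℕ} (h : n ≤ u) (φ : G → M) (x : M) :
    X.cross (u, φ) x ≤ X.cross (n, φ) x + X.d u n := by
  rw [← sub_le_iff_le_add]
  refine X.le_cross (by linarith [X.cross_le_one (u, φ) x, X.d_nonneg u n]) fun k s hk => ?_
  linarith [X.cross_le (hk.trans h) s φ x, X.d_triangle u n k]

lemma cross_le_cross_add_d (n u : ℕ) (φ : G → M) (x : M) :
    X.cross (n, φ) x ≤ X.cross (u, φ) x + X.d n u := by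
  rw [← sub_le_iff_le_add]
  refine X.le_cross (by linarith [X.cross_le_one (n, φ) x, X.d_nonneg n u]) fun k s hk => ?_
  rcases le_total k n with hkn | hkn
  · linarith [X.cross_le hkn s φ x, X.d_triangle n u k]
  · have h₁ := X.cross_le le_rfl s φ x (w := n)
    rw [X.d_self] at h₁
    linarith [X.defect_mono hkn φ x s, X.d_triangle n k s, X.d_triangle n u k]

lemma cross_congr {n : ℕ} {φ ψ : G → M} (h : ∀ c, X.stage c ≤ n → φ c = ψ c) (x : M) :
    X.cross (n, φ) x = X.cross (n, ψ) x := by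
  refine iInf_congr fun i => ?_
  unfold cost
  split_ifs with hi
  · rw [X.defect_congr (fun c hc => h c (hc.trans hi))]
  · rfl

lemma cross_le_r {v : ℕ} {φ : G → M} {x : M} (h : ∀ c, X.dM x (φ c) = X.ρ v c) :
    X.cross (v, φ) x ≤ X.r := by
  have h₁ := X.cross_le le_rfl v φ x (w := v)
  have h₂ : X.defect v φ x v ≤ 0 := X.defect_le le_rfl fun c _ => by simp [h]
  rw [X.d_self] at h₁
  linarith

/-- `(u, φ)` and `(v, ψ)` branch off at stage `n` or later. -/
def Agree (p q : ℕ × (G → M)) (n : ℕ) : Prop :=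
  n ≤ p.1 ∧ n ≤ q.1 ∧ ∀ c, X.stage c ≤ n → p.2 c = q.2 c

open Classical in
/-- The cost of going from `(u, φ)` to `(v, ψ)` through `(n, φ)`. -/
noncomputable def treeCost (p q : ℕ × (G → M)) (n : ℕ) : ℝ :=
  if X.Agree p q n then min 1 (X.d p.1 n + X.d n q.1) else 1

lemma treeCost_nonneg (p q : ℕ × (G → M)) (n : ℕ) : 0 ≤ X.treeCost p q n := by
  have h₁ := X.d_nonneg p.1 n
  have h₂ := X.d_nonneg n q.1
  unfold treeCost
  split_ifs
  · exact le_min zero_le_one (by linarith)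
  · exact zero_le_one

lemma treeCost_eq_one_or (p q : ℕ × (G → M)) (n : ℕ) :
    X.treeCost p q n = 1 ∨ X.Agree p q n ∧ X.treeCost p q n = X.d p.1 n + X.d n q.1 := by
  unfold treeCost
  split_ifs with h
  · rcases min_choice 1 (X.d p.1 n + X.d n q.1) with h' | h'
    · exact .inl h'
    · exact .inr ⟨h, h'⟩
  · exact .inl rfl

lemma treeCost_le {p q : ℕ × (G → M)} {n : ℕ} (h : X.Agree p q n) :
    X.treeCost p q n ≤ X.d p.1 n + X.d n q.1 := by
  rw [treeCost, if_pos h]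
  exact min_le_right _ _

/-- The tree distance between two new points. -/
noncomputable def treeDist (p q : ℕ × (G → M)) : ℝ := ⨅ n, X.treeCost p q n

lemma treeDist_le_treeCost (p q : ℕ × (G → M)) (n : ℕ) : X.treeDist p q ≤ X.treeCost p q n :=
  ciInf_le ⟨0, by rintro _ ⟨i, rfl⟩; exact X.treeCost_nonneg p q i⟩ n

lemma treeDist_le {p q : ℕ × (G → M)} {n : ℕ} (h : X.Agree p q n) :
    X.treeDist p q ≤ X.d p.1 n + X.d n q.1 :=
  (X.treeDist_le_treeCost p q n).trans (X.treeCost_le h)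

lemma treeDist_nonneg (p q : ℕ × (G → M)) : 0 ≤ X.treeDist p q :=
  Real.iInf_nonneg (X.treeCost_nonneg p q)

lemma treeDist_le_one (p q : ℕ × (G → M)) : X.treeDist p q ≤ 1 := by
  refine (X.treeDist_le_treeCost p q 0).trans ?_
  unfold treeCost
  split_ifs
  · exact min_le_left _ _
  · exact le_rfl

lemma le_treeDist {p q : ℕ × (G → M)} {a : ℝ} (ha : a ≤ 1)
    (h : ∀ n, X.Agree p q n → a ≤ X.d p.1 n + X.d n q.1) : a ≤ X.treeDist p q := by
  refine le_ciInf fun n => ?_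
  rcases X.treeCost_eq_one_or p q n with hn | ⟨hn, hn'⟩
  · exact ha.trans_eq hn.symm
  · exact (h n hn).trans_eq hn'.symm

lemma treeDist_eq_zero {n : ℕ} {φ ψ : G → M} (h : ∀ c, X.stage c ≤ n → φ c = ψ c) :
    X.treeDist (n, φ) (n, ψ) = 0 := by
  refine le_antisymm ?_ (X.treeDist_nonneg _ _)
  have := X.treeDist_le (p := (n, φ)) (q := (n, ψ)) (n := n) ⟨le_rfl, le_rfl, h⟩
  simpa [X.d_self] using this

lemma treeDist_same (u v : ℕ) (φ : G → M) : X.treeDist (u, φ) (v, φ) = X.d u v := by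
  refine le_antisymm ?_ (X.le_treeDist (X.d_le_one u v) fun n _ => X.d_triangle u n v)
  rcases le_total u v with h | h
  · have := X.treeDist_le (p := (u, φ)) (q := (v, φ)) (n := u) ⟨le_rfl, h, fun _ _ => rfl⟩
    simpa [X.d_self] using this
  · have := X.treeDist_le (p := (u, φ)) (q := (v, φ)) (n := v) ⟨h, le_rfl, fun _ _ => rfl⟩
    simpa [X.d_self] using this

lemma treeDist_comm (p q : ℕ × (G → M)) : X.treeDist p q = X.treeDist q p := by
  have key : ∀ p q, X.treeDist p q ≤ X.treeDist q p := fun p q =>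
    X.le_treeDist (X.treeDist_le_one p q) fun n ⟨h₁, h₂, h₃⟩ => by
      have := X.treeDist_le (p := p) (q := q) ⟨h₂, h₁, fun c hc => (h₃ c hc).symm⟩
      linarith [X.d_comm p.1 n, X.d_comm n q.1]
  exact le_antisymm (key p q) (key q p)

lemma treeDist_triangle (p q o : ℕ × (G → M)) :
    X.treeDist p o ≤ X.treeDist p q + X.treeDist q o := by
  refine le_ciInf_add_ciInf fun n n' => ?_
  have h₀ := X.treeDist_le_one p o
  have h₁ := X.treeCost_nonneg p q n
  have h₂ := X.treeCost_nonneg q o n'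
  rcases X.treeCost_eq_one_or p q n with hn | ⟨⟨hp, hq, ha⟩, hn⟩
  · linarith
  rcases X.treeCost_eq_one_or q o n' with hn' | ⟨⟨hq', ho, ha'⟩, hn'⟩
  · linarith
  rw [hn, hn']
  rcases le_total n n' with h | h
  · have := X.treeDist_le (p := p) (q := o) ⟨hp, h.trans ho,
      fun c hc => (ha c hc).trans (ha' c (hc.trans h))⟩
    linarith [X.d_triangle n q.1 o.1, X.d_triangle q.1 n' o.1]
  · have := X.treeDist_le (p := p) (q := o) ⟨h.trans hp, ho,
      fun c hc => (ha c (hc.trans h)).trans (ha' c hc)⟩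
    linarith [X.d_triangle p.1 q.1 n', X.d_triangle p.1 n q.1]

lemma cross_le_add_treeDist (p q : ℕ × (G → M)) (x : M) :
    X.cross p x ≤ X.treeDist p q + X.cross q x := by
  obtain ⟨u, φ⟩ := p
  obtain ⟨v, ψ⟩ := q
  rw [← sub_le_iff_le_add]
  refine X.le_treeDist (by linarith [X.cross_le_one (u, φ) x, X.cross_nonneg (v, ψ) x])
    fun n ⟨h₁, _, h₃⟩ => ?_
  have h₄ := X.cross_congr h₃ x
  linarith [X.cross_le_add_d_of_le h₁ φ x, X.cross_le_cross_add_d n v ψ x]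

/-- The distance between two new points, going through the tree or through `M`. -/
noncomputable def newDist (p q : ℕ × (G → M)) : ℝ :=
  min (X.treeDist p q) (⨅ x, (X.cross p x + X.cross q x))

lemma newDist_le_add (p q : ℕ × (G → M)) (x : M) :
    X.newDist p q ≤ X.cross p x + X.cross q x :=
  (min_le_right _ _).trans (ciInf_le ⟨0, by
    rintro _ ⟨x, rfl⟩; exact add_nonneg (X.cross_nonneg p x) (X.cross_nonneg q x)⟩ x)

lemma newDist_le_treeDist (p q : ℕ × (G → M)) : X.newDist p q ≤ X.treeDist p q := min_le_left _ _

lemma newDist_comm (p q : ℕ × (G → M)) : X.newDist p q = X.newDist q p := by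
  simp only [newDist, X.treeDist_comm p q, add_comm]

lemma le_newDist [Nonempty M] {p q : ℕ × (G → M)} {a : ℝ} (h₁ : a ≤ X.treeDist p q)
    (h₂ : ∀ x, a ≤ X.cross p x + X.cross q x) : a ≤ X.newDist p q :=
  le_min h₁ (le_ciInf h₂)

lemma cross_le_add_newDist [Nonempty M] (p q : ℕ × (G → M)) (x : M) :
    X.cross p x ≤ X.newDist p q + X.cross q x := by
  rw [← sub_le_iff_le_add]
  refine X.le_newDist (by linarith [X.cross_le_add_treeDist p q x]) fun y => ?_
  linarith [X.cross_le_add_dM p x y, X.dM_le_cross_add_cross q x y]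

lemma newDist_triangle [Nonempty M] (p q o : ℕ × (G → M)) :
    X.newDist p o ≤ X.newDist p q + X.newDist q o := by
  rw [← sub_le_iff_le_add]
  refine X.le_newDist ?_ fun x => ?_
  · rw [sub_le_iff_le_add, ← sub_le_iff_le_add']
    refine X.le_newDist ?_ fun x => ?_
    · linarith [X.newDist_le_treeDist p o, X.treeDist_triangle p q o]
    · linarith [X.newDist_le_add p o x, X.cross_le_add_treeDist p q x]
  · have := X.cross_le_add_newDist o q x
    rw [X.newDist_comm o q] at this
    linarith [X.newDist_le_add p o x]

/-- The distance on the union of `M` and of the new points. -/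
noncomputable def gluedDist : M ⊕ ℕ × (G → M) → M ⊕ ℕ × (G → M) → ℝ
  | .inl x, .inl y => X.dM x y
  | .inl x, .inr p => X.cross p x
  | .inr p, .inl x => X.cross p x
  | .inr p, .inr q => X.newDist p q

/-- The glued pseudometric space. -/
@[reducible] noncomputable def gluedPseudoMetricSpace [Nonempty M] :
    PseudoMetricSpace (M ⊕ ℕ × (G → M)) where
  dist := X.gluedDist
  dist_self
    | .inl x => X.dM_self x
    | .inr p => le_antisymm
        ((X.newDist_le_treeDist p p).trans_eq (X.treeDist_eq_zero fun _ _ => rfl))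
        (X.le_newDist (X.treeDist_nonneg p p) fun x =>
          add_nonneg (X.cross_nonneg p x) (X.cross_nonneg p x))
  dist_comm
    | .inl x, .inl y => X.dM_comm x y
    | .inl _, .inr _ => rfl
    | .inr _, .inl _ => rfl
    | .inr p, .inr q => X.newDist_comm p q
  dist_triangle
    | .inl x, .inl y, .inl z => X.dM_triangle x y z
    | .inl x, .inl y, .inr p => (X.cross_le_add_dM p x y).trans_eq (add_comm _ _)
    | .inl x, .inr p, .inl y => X.dM_le_cross_add_cross p x y
    | .inl x, .inr p, .inr q => by
      have := X.cross_le_add_newDist q p x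
      rw [X.newDist_comm, add_comm] at this
      exact this
    | .inr p, .inl x, .inl y => by
      have := X.cross_le_add_dM p y x
      rw [X.dM_comm] at this
      exact this
    | .inr p, .inl x, .inr q => X.newDist_le_add p q x
    | .inr p, .inr q, .inl x => X.cross_le_add_newDist p q x
    | .inr p, .inr q, .inr o => X.newDist_triangle p q o

lemma exists_gluing [Nonempty M] [Countable M]
    (hfin : ∀ w, Finite {c : G // X.stage c ≤ w}) :
    ∃ (Z : Type) (_ : MetricSpace Z) (a : M → Z) (p : ℕ → (G → M) → Z),
      TopologicalSpace.SeparableSpace Z ∧ (∀ z z' : Z, dist z z' ≤ 1) ∧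
      (∀ x y, dist (a x) (a y) = X.dM x y) ∧
      (∀ u v φ, dist (p u φ) (p v φ) = X.d u v) ∧
      ∀ v φ x, (∀ c, X.dM x (φ c) = X.ρ v c) → dist (p v φ) (a x) ≤ X.r := by
  let _ := X.gluedPseudoMetricSpace
  let p : ℕ → (G → M) → SeparationQuotient (M ⊕ ℕ × (G → M)) := fun w φ =>
    SeparationQuotient.mk (.inr (w, φ))
  have hp : ∀ w, (Set.range (p w)).Countable := fun w => by
    have := hfin w
    obtain ⟨e, he⟩ := (Function.factorsThrough_iff (p w)
      (f := fun φ (c : {c : G // X.stage c ≤ w}) => φ c)).1 (fun φ ψ h => by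
        refine SeparationQuotient.mk_eq_mk.2 (Metric.inseparable_iff.2 (le_antisymm ?_ dist_nonneg))
        exact (X.newDist_le_treeDist _ _).trans_eq
          (X.treeDist_eq_zero fun c hc => congrFun h ⟨c, hc⟩))
    rw [he]
    exact (Set.countable_range e).mono (Set.range_comp_subset_range _ _)
  have hZ : Countable (SeparationQuotient (M ⊕ ℕ × (G → M))) := by
    rw [← Set.countable_univ_iff]
    refine ((Set.countable_range fun x : M => SeparationQuotient.mk (.inl x)).union
      (Set.countable_iUnion hp)).mono fun z _ => ?_
    obtain ⟨x | ⟨w, φ⟩, rfl⟩ := SeparationQuotient.surjective_mk z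
    · exact .inl ⟨x, rfl⟩
    · exact .inr (Set.mem_iUnion.2 ⟨w, φ, rfl⟩)
  refine ⟨SeparationQuotient (M ⊕ ℕ × (G → M)), inferInstance,
    fun x => SeparationQuotient.mk (.inl x), p, inferInstance, fun z z' => ?_, fun x y => ?_,
    fun u v φ => ?_, fun v φ x h => ?_⟩
  · obtain ⟨z, rfl⟩ := SeparationQuotient.surjective_mk z
    obtain ⟨z', rfl⟩ := SeparationQuotient.surjective_mk z'
    rw [SeparationQuotient.dist_mk]
    rcases z with x | p <;> rcases z' with y | q
    · exact X.dM_le_one x y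
    · exact X.cross_le_one q x
    · exact X.cross_le_one p y
    · exact (X.newDist_le_treeDist p q).trans (X.treeDist_le_one p q)
  · rw [SeparationQuotient.dist_mk]
    rfl
  · rw [SeparationQuotient.dist_mk]
    exact le_antisymm ((X.newDist_le_treeDist _ _).trans_eq (X.treeDist_same u v φ))
      (X.le_newDist (X.treeDist_same u v φ).ge (X.d_le_cross_add_cross u v φ))
  · rw [SeparationQuotient.dist_mk]
    exact X.cross_le_r h

end StagedData

lemma IsUrysohnSphereM.exists_gluing {m : ℕ} (hm : 0 < m) {Sm S : Type} [MetricSpace Sm]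
    [MetricSpace S] (hSm : IsUrysohnSphereM m Sm) (hS : ∀ x y : S, dist x y ≤ 1) (y : ℕ → S) :
    ∃ (Z : Type) (_ : MetricSpace Z) (a : Sm → Z),
      TopologicalSpace.SeparableSpace Z ∧ (∀ z z' : Z, dist z z' ≤ 1) ∧
      (∀ x x', dist (a x) (a x') =
        dist x x' * ((2 * m + 3) * m / ((2 * m + 3) * m + m + 1))) ∧
      ∀ e : Sm → Sm, Isometry e → ∃ p : ℕ → Z, (∀ i j, dist (p i) (p j) = dist (y i) (y j)) ∧
        ∀ i, ∃ x, dist (p i) (a (e x)) ≤ (m + 3) / ((2 * m + 3) * m + m + 1) := by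
  obtain ⟨hcount, -, hdist, huniv⟩ := hSm
  set H := m + 1
  set B := (2 * m + 3) * m + m + 1
  set C := B + H
  set R : ℝ := (2 * m + 3) * m + m + 1 with hR
  have hRB : R = (B : ℕ) := by simp only [B]; push_cast; rw [hR]
  have hR0 : 0 < R := by positivity
  have hm0 : (0 : ℝ) < m := by exact_mod_cast hm
  let δ : ℕ → ℕ → ℕ := fun i j => ⌈dist (y i) (y j) * R⌉₊
  have hself : ∀ i, δ i i = 0 := fun i => by simp [δ]
  have hcomm : ∀ i j, δ i j = δ j i := fun i j => by simp only [δ, dist_comm]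
  have htri : ∀ i j k, δ i k ≤ δ i j + δ j k := fun i j k => by
    refine le_trans (Nat.ceil_mono ?_) (Nat.ceil_add_le _ _)
    rw [← add_mul]
    exact mul_le_mul_of_nonneg_right (dist_triangle _ _ _) hR0.le
  have hB : ∀ i j, δ i j ≤ B := fun i j => by
    refine Nat.ceil_le.2 ?_
    rw [← hRB]
    exact mul_le_of_le_one_left hR0.le (hS _ _)
  have hBm : B ≤ m * (2 * H + 1) + H := by simp only [B, H]; exact le_of_eq (by ring)
  have hδ : IsNatDist δ B := ⟨hself, hcomm, htri, hB⟩
  have hceil : ∀ i j, dist (y i) (y j) * R ≤ δ i j ∧ (δ i j : ℝ) ≤ dist (y i) (y j) * R + 1 :=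
    fun i j => ⟨Nat.le_ceil _, (Nat.ceil_lt_add_one (by positivity)).le⟩
  let := TypeCode.metricSpace (H := H) (C := C) m hm
  obtain ⟨g, hg⟩ := huniv (TypeCode H C) inferInstance fun a b =>
    ⟨min (TypeCode.chainDist a b) m, min_le_right _ _, rfl⟩
  let π : ℕ → TypeCode H C := TypeCode.code hδ le_rfl
  have hSm1 : ∀ x x' : Sm, dist x x' ≤ 1 := fun x x' => by
    obtain ⟨k, hk, hk'⟩ := hdist x x'
    rw [hk', div_le_one hm0]
    exact_mod_cast hk
  set θ : ℝ := (2 * m + 3) * m / R with hθ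
  have hθ0 : 0 ≤ θ := by positivity
  have hθ1 : θ ≤ 1 := by
    rw [hθ, div_le_one hR0]
    linarith
  have hG : ∀ a b : TypeCode H C,
      dist a b * θ * R = ((min (TypeCode.chainDist a b) m : ℕ) : ℝ) * (2 * m + 3) := fun a b => by
    change ((min (TypeCode.chainDist a b) m : ℕ) : ℝ) / m * θ * R = _
    rw [hθ]
    field_simp
  have hG1 : ∀ a b : TypeCode H C, dist a b ≤ 1 := fun a b => by
    rw [← hg.dist_eq]
    exact hSm1 _ _
  let X : StagedData Sm (TypeCode H C) :=
    { dM := fun x x' => dist x x' * θ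
      d := fun i j => dist (y i) (y j)
      ρ := fun s c => dist (π s) c * θ
      stage := TypeCode.stage
      r := (m + 3) / R
      dM_self := fun x => by simp
      dM_comm := fun x x' => by rw [dist_comm]
      dM_triangle := fun x x' x'' => by
        rw [← add_mul]
        exact mul_le_mul_of_nonneg_right (dist_triangle _ _ _) hθ0
      dM_nonneg := fun x x' => by positivity
      dM_le_one := fun x x' => mul_le_one₀ (hSm1 _ _) hθ0 hθ1
      d_self := fun i => dist_self _
      d_comm := fun i j => dist_comm _ _
      d_triangle := fun i j k => dist_triangle _ _ _
      d_nonneg := fun i j => dist_nonneg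
      d_le_one := fun i j => hS _ _
      ρ_nonneg := fun s c => by positivity
      ρ_le_one := fun s c => mul_le_one₀ (hG1 _ _) hθ0 hθ1
      r_nonneg := by positivity
      exists_add_le := fun s t w => by
        obtain ⟨c, hc, h⟩ :=
          TypeCode.exists_chainDist_add_le hδ le_rfl s t w
        refine ⟨c, hc, le_of_mul_le_mul_right ?_ hR0⟩
        have h₁ := hceil s w
        have h₂ := hceil t w
        have h₃ : (min (TypeCode.chainDist (π s) c) m + min (TypeCode.chainDist (π t) c) m) *
            (2 * m + 3) ≤ δ s w + δ t w + (2 * m + 3) + 1 :=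
          (Nat.mul_le_mul_right _ (Nat.add_le_add (min_le_left _ _) (min_le_left _ _))).trans h
        have h₄ : (((min (TypeCode.chainDist (π s) c) m : ℕ) : ℝ) +
            (min (TypeCode.chainDist (π t) c) m : ℕ)) * (2 * m + 3) ≤
              δ s w + δ t w + (2 * m + 3) + 1 := by exact_mod_cast h₃
        rw [add_mul, hG, hG]
        have h₅ : (2 * ((m + 3) / R) + dist (y s) (y w) + dist (y t) (y w)) * R =
            2 * (m + 3) + dist (y s) (y w) * R + dist (y t) (y w) * R := by field_simp
        rw [h₅]
        linarith
      exists_abs_sub_le := fun s t w => by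
        obtain ⟨c, hc, h⟩ :=
          TypeCode.exists_abs_sub_le hδ le_rfl hBm s t w
        refine ⟨c, hc, le_of_mul_le_mul_right ?_ hR0⟩
        have h₁ := hceil s w
        have h₂ := hceil t w
        have h₃ : |(δ s w : ℝ) - δ t w| ≤ (2 * m + 3) +
            |((min (TypeCode.chainDist (π s) c) m : ℕ) : ℝ) -
              (min (TypeCode.chainDist (π t) c) m : ℕ)| * (2 * m + 3) := by
          have h' : |(δ s w : ℤ) - δ t w| ≤ (2 * m + 3) +
            |((min (TypeCode.chainDist (π s) c) m : ℕ) : ℤ) -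
              (min (TypeCode.chainDist (π t) c) m : ℕ)| * (2 * m + 3) := by
            refine h.trans_eq ?_
            simp only [H, π]
            push_cast
            ring
          exact_mod_cast h'
        have h₄ : (2 * ((m + 3) / R) + |dist (π s) c * θ - dist (π t) c * θ|) * R =
            2 * (m + 3) + |((min (TypeCode.chainDist (π s) c) m : ℕ) : ℝ) -
              (min (TypeCode.chainDist (π t) c) m : ℕ)| * (2 * m + 3) := by
          rw [add_mul, ← abs_of_pos hR0, ← abs_mul, abs_of_pos hR0, sub_mul, hG, hG, ← sub_mul,
            abs_mul, abs_of_nonneg (show (0 : ℝ) ≤ 2 * m + 3 by positivity)]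
          field_simp
        rw [h₄, ← abs_of_pos hR0, ← abs_mul, sub_mul]
        have h₅ := abs_le.1 h₃
        exact abs_le.2 ⟨by linarith, by linarith⟩ }
  have : Nonempty Sm := ⟨g (π 0)⟩
  obtain ⟨Z, hZ, a, p, hsep, hZ1, ha, hp, hpa⟩ := X.exists_gluing TypeCode.finite_stage_le
  refine ⟨Z, hZ, a, hsep, hZ1, ha, fun e he =>
    ⟨fun i => p i (e ∘ g), fun i j => hp i j _, fun i => ⟨g (π i), hpa i _ _ fun c => ?_⟩⟩⟩
  change dist (e (g (π i))) (e (g c)) * θ = dist (π i) c * θ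
  rw [he.dist_eq, hg.dist_eq]

lemma DenseRange.exists_isometry_extend {X Y : Type*} [MetricSpace X] [MetricSpace Y]
    [CompleteSpace Y] {y : ℕ → X} (hy : DenseRange y) {q : ℕ → Y}
    (hq : ∀ i j, dist (q i) (q j) = dist (y i) (y j)) :
    ∃ E : X → Y, Isometry E ∧ ∀ i, E (y i) = q i := by
  choose idx hidx using fun x : Set.range y => x.2
  let f : Set.range y → Y := fun x => q (idx x)
  have hf : Isometry f := Isometry.of_dist_eq fun x x' => by
    rw [hq, hidx, hidx, Subtype.dist_eq]
  have hi : IsUniformInducing ((↑) : Set.range y → X) :=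
    isUniformEmbedding_subtype_val.isUniformInducing
  have hd : DenseRange ((↑) : Set.range y → X) := by
    rw [DenseRange, Subtype.range_coe]
    exact hy
  have hE := (uniformContinuous_uniformly_extend hi hd hf.uniformContinuous).continuous
  have hEy : ∀ i, (hi.isDenseInducing hd).extend f (y i) = q i := fun i => by
    refine ((hi.isDenseInducing hd).extend_eq hf.continuous ⟨y i, i, rfl⟩).trans
      (dist_le_zero.1 ?_)
    rw [hq, hidx, dist_self]
  refine ⟨_, Isometry.of_dist_eq fun x x' => ?_, hEy⟩
  refine isClosed_property2
    (p := fun x x' => dist ((hi.isDenseInducing hd).extend f x)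
      ((hi.isDenseInducing hd).extend f x') = dist x x') hy
    (isClosed_eq ?_ continuous_dist) (fun i j => ?_) x x'
  · exact (hE.comp continuous_fst).dist (hE.comp continuous_snd)
  · rw [hEy, hEy, hq]

/-- If `S_m` is `1/m`-indivisible, then every Urysohn sphere is
`ε`-indivisible for every `ε ≥ 3/(2m)`. -/
theorem stmt15 (m : ℕ) (hm : 0 < m)
    (h : ∃ (Sm : Type) (_ : MetricSpace Sm),
      IsUrysohnSphereM m Sm ∧ EpsIndivisible Sm (1/(m:ℝ)))
    (S : Type) [MetricSpace S] (hS : IsUrysohnSphere S) :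
    ∀ ε : ℝ, 3 / (2 * (m : ℝ)) ≤ ε → EpsIndivisible S ε := by
  obtain ⟨Sm, _, hSm, hind⟩ := h
  obtain ⟨hcomplete, hsep, -, hS1, huniv⟩ := hS
  obtain ⟨s₀, -⟩ := huniv Unit inferInstance fun a b => by simp
  have : Nonempty S := ⟨s₀ ()⟩
  let y := TopologicalSpace.denseSeq S
  have hy : DenseRange y := TopologicalSpace.denseRange_denseSeq S
  obtain ⟨Z, _, a, hZsep, hZ1, ha, hp⟩ := hSm.exists_gluing hm hS1 y
  obtain ⟨J, hJ⟩ := huniv Z hZsep hZ1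
  intro ε hε k hk χ
  obtain ⟨i, e, he, hcol⟩ := hind k hk fun x => χ (J (a x))
  obtain ⟨p, hpp, hpa⟩ := hp e he
  obtain ⟨E, hE, hEy⟩ := hy.exists_isometry_extend (q := fun n => J (p n))
    fun n n' => by rw [hJ.dist_eq, hpp]
  refine ⟨i, E, hE, fun z => ?_⟩
  have hm0 : (0 : ℝ) < m := by exact_mod_cast hm
  set R : ℝ := (2 * m + 3) * m + m + 1 with hR
  have hR0 : 0 < R := by positivity
  have hslack : (m + 3) / R + (2 * m + 3) / R < ε := by
    refine lt_of_lt_of_le ?_ hε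
    rw [← add_div, div_lt_div_iff₀ hR0 (by positivity), hR]
    nlinarith
  obtain ⟨n, hn⟩ := hy.exists_dist_lt z (sub_pos.2 hslack)
  obtain ⟨x, hx⟩ := hpa n
  obtain ⟨x', hx', hd⟩ := hcol x
  refine ⟨J (a x'), hx', ?_⟩
  have h₁ := dist_triangle (E z) (E (y n)) (J (a x'))
  rw [hE.dist_eq, hEy, hJ.dist_eq] at h₁
  have h₂ := dist_triangle (p n) (a (e x)) (a x')
  have h₃ : dist (a (e x)) (a x') ≤ (2 * m + 3) / R := by
    rw [ha]
    refine (mul_le_mul_of_nonneg_right hd (by positivity)).trans_eq ?_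
    field_simp
  linarith
end
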